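/- arXiv:2411.17929 — 2 statements merged into one kernel-verified Lean document; each statement's English description precedes it below -/
import Mathlib

section
/- Let Ū ∈ C_c^∞(ℝ³;ℝ³) be divergence-free and let Θ be an admissible solution on [0,∞) of ∂_τΘ = ΔΘ + ½Θ + ½ξ·∇Θ − Ū·∇Θ. Then for all τ ≥ 0: ‖Θ(·,τ)‖_{L²(ℝ³)} ≤ e^{−τ/4}·‖Θ(·,0)‖_{L²(ℝ³)}. -/
noncomputable section

open MeasureTheory
open scoped ENNReal BigOperators

/-- Three-dimensional Euclidean space. -/
abbrev E3 : Type := EuclideanSpace ℝ (Fin 3)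

/-- Spatial partial derivative `∂ᵢ F` of a scalar function. -/
noncomputable def pd (F : E3 → ℝ) (i : Fin 3) (x : E3) : ℝ :=
  fderiv ℝ F x (EuclideanSpace.single i 1)

/-- Laplacian `ΔF` of a scalar function. -/
noncomputable def lap (F : E3 → ℝ) (x : E3) : ℝ :=
  ∑ i, pd (fun y => pd F i y) i x

/-- Spatial divergence `∇·u` of a vector field. -/
noncomputable def divg (u : E3 → E3) (x : E3) : ℝ :=
  ∑ i, pd (fun y => u y i) i x

/-- The squared Sobolev `H^m` norm `∑_{j=0}^m ∫ ‖∇ʲ g‖²`. -/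
noncomputable def sobSq (m : ℕ) (g : E3 → ℝ) : ℝ :=
  ∑ j ∈ Finset.range (m + 1), ∫ x : E3, ‖iteratedFDeriv ℝ j g x‖ ^ 2

/-- The drift–diffusion operator in self-similar variables,
`L Θ = ΔΘ + ½Θ + ½ ξ·∇Θ − Ū·∇Θ`, evaluated at `ξ` on the time slice `Θ`. -/
noncomputable def Lgen (Ubar : E3 → E3) (Θ : E3 → ℝ) (ξ : E3) : ℝ :=
  lap Θ ξ + (1 / 2) * Θ ξ + (1 / 2) * (∑ i, ξ i * pd Θ i ξ)
    - ∑ i, Ubar ξ i * pd Θ i ξ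

/-- `Θ` is an admissible solution, on the time interval `I`, of the drift–diffusion
equation `∂_τΘ = ΔΘ + ½Θ + ½ξ·∇Θ − Ū·∇Θ`: it is smooth, solves the equation pointwise,
and together with all its spatial derivatives decays in `ξ` faster than any polynomial,
locally uniformly in `τ`. -/
def IsAdmissibleSS (Ubar : E3 → E3) (I : Set ℝ) (Θ : E3 → ℝ → ℝ) : Prop :=
  ContDiffOn ℝ (⊤ : ℕ∞) (fun q : E3 × ℝ => Θ q.1 q.2) {q : E3 × ℝ | q.2 ∈ I} ∧
  (∀ (ξ : E3) (τ : ℝ), τ ∈ I →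
    deriv (fun s => Θ ξ s) τ = Lgen Ubar (fun y => Θ y τ) ξ) ∧
  (∀ (n k : ℕ) (a b : ℝ), ∃ C : ℝ, ∀ (ξ : E3) (τ : ℝ), τ ∈ I → a ≤ τ → τ ≤ b →
    ‖ξ‖ ^ n * ‖iteratedFDeriv ℝ k (fun y => Θ y τ) ξ‖ ≤ C)

/-- `F` decays faster than any polynomial in the space variable, uniformly for times in `I`. -/
def RapidOn (I : Set ℝ) (F : E3 → ℝ → ℝ) : Prop :=
  ∀ n : ℕ, ∃ C : ℝ, ∀ (x : E3) (t : ℝ), t ∈ I → ‖x‖ ^ n * |F x t| ≤ C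

namespace RapidOn

variable {I : Set ℝ} {F G : E3 → ℝ → ℝ}

theorem of_abs_le (hF : RapidOn I F) (h : ∀ x, ∀ t ∈ I, |G x t| ≤ |F x t|) : RapidOn I G := by
  intro n
  obtain ⟨C, hC⟩ := hF n
  exact ⟨C, fun x t ht =>
    (mul_le_mul_of_nonneg_left (h x t ht) (by positivity)).trans (hC x t ht)⟩

theorem add (hF : RapidOn I F) (hG : RapidOn I G) : RapidOn I (fun x t => F x t + G x t) := by
  intro n
  obtain ⟨C, hC⟩ := hF n
  obtain ⟨D, hD⟩ := hG n
  refine ⟨C + D, fun x t ht => ?_⟩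
  calc ‖x‖ ^ n * |F x t + G x t| ≤ ‖x‖ ^ n * (|F x t| + |G x t|) := by
        gcongr
        exact abs_add_le _ _
    _ ≤ C + D := by
        rw [mul_add]
        exact add_le_add (hC x t ht) (hD x t ht)

theorem bdd_mul {B : ℝ} (hF : RapidOn I F) (hG : ∀ x, ∀ t ∈ I, |G x t| ≤ B) :
    RapidOn I (fun x t => G x t * F x t) := by
  intro n
  obtain ⟨C, hC⟩ := hF n
  refine ⟨B * C, fun x t ht => ?_⟩
  have hB : 0 ≤ B := (abs_nonneg _).trans (hG x t ht)
  calc ‖x‖ ^ n * |G x t * F x t| = |G x t| * (‖x‖ ^ n * |F x t|) := by rw [abs_mul]; ring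
    _ ≤ B * C := mul_le_mul (hG x t ht) (hC x t ht) (by positivity) hB

theorem const_mul (c : ℝ) (hF : RapidOn I F) : RapidOn I (fun x t => c * F x t) :=
  hF.bdd_mul (G := fun _ _ => c) fun _ _ _ => le_rfl

theorem mul (hG : RapidOn I G) (hF : RapidOn I F) : RapidOn I (fun x t => G x t * F x t) := by
  obtain ⟨C, hC⟩ := hG 0
  exact hF.bdd_mul (B := C) fun x t ht => by simpa using hC x t ht

theorem coord_mul (i : Fin 3) (hF : RapidOn I F) : RapidOn I (fun x t => x i * F x t) := by
  intro n
  obtain ⟨C, hC⟩ := hF (n + 1)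
  refine ⟨C, fun x t ht => le_trans ?_ (hC x t ht)⟩
  have h : |x i| ≤ ‖x‖ := PiLp.norm_apply_le x i
  calc ‖x‖ ^ n * |x i * F x t| = ‖x‖ ^ n * |x i| * |F x t| := by rw [abs_mul]; ring
    _ ≤ ‖x‖ ^ n * ‖x‖ * |F x t| := by gcongr
    _ = ‖x‖ ^ (n + 1) * |F x t| := by ring

theorem sum {F : Fin 3 → E3 → ℝ → ℝ} (hF : ∀ i, RapidOn I (F i)) :
    RapidOn I (fun x t => ∑ i, F i x t) := by
  simp only [Fin.sum_univ_three]
  exact ((hF 0).add (hF 1)).add (hF 2)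

theorem exists_integrable_bound (hF : RapidOn I F) :
    ∃ b : E3 → ℝ, Integrable b ∧ ∀ x, ∀ t ∈ I, ‖F x t‖ ≤ b x := by
  obtain ⟨C, hC⟩ := hF 0
  obtain ⟨D, hD⟩ := hF 4
  refine ⟨fun x => 2 ^ 4 * (C + D) * (1 + ‖x‖) ^ (-((4 : ℕ) : ℝ)),
    (integrable_one_add_norm (by simp; norm_num)).const_mul _, fun x t ht => ?_⟩
  simpa using pow_mul_le_of_le_of_pow_mul_le (k := 0) (l := 4) (norm_nonneg x)
    (abs_nonneg (F x t)) (by simpa using hC x t ht) (by simpa using hD x t ht)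

theorem integrable (hF : RapidOn I F) {t : ℝ} (ht : t ∈ I) (hc : Continuous fun x => F x t) :
    Integrable fun x => F x t := by
  obtain ⟨b, hb, hFb⟩ := hF.exists_integrable_bound
  exact hb.mono' hc.aestronglyMeasurable (.of_forall fun x => hFb x t ht)

end RapidOn

theorem pd_mul {F G : E3 → ℝ} {x : E3} (hF : DifferentiableAt ℝ F x)
    (hG : DifferentiableAt ℝ G x) (i : Fin 3) :
    pd (fun y => F y * G y) i x = F x * pd G i x + G x * pd F i x := by
  simp [pd, fderiv_fun_mul hF hG]

theorem pd_add {F G : E3 → ℝ} {x : E3} (hF : DifferentiableAt ℝ F x)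
    (hG : DifferentiableAt ℝ G x) (i : Fin 3) :
    pd (fun y => F y + G y) i x = pd F i x + pd G i x := by
  simp [pd, fderiv_fun_add hF hG]

theorem pd_sub {F G : E3 → ℝ} {x : E3} (hF : DifferentiableAt ℝ F x)
    (hG : DifferentiableAt ℝ G x) (i : Fin 3) :
    pd (fun y => F y - G y) i x = pd F i x - pd G i x := by
  simp [pd, fderiv_fun_sub hF hG]

theorem pd_const_mul {F : E3 → ℝ} {x : E3} (hF : DifferentiableAt ℝ F x) (c : ℝ) (i : Fin 3) :
    pd (fun y => c * F y) i x = c * pd F i x := by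
  simp [pd, fderiv_const_mul hF]

theorem pd_coord (i : Fin 3) (x : E3) : pd (fun y => y i) i x = 1 := by
  have h : HasFDerivAt (fun y : E3 => y i) (EuclideanSpace.proj (𝕜 := ℝ) i : E3 →L[ℝ] ℝ) x :=
    (EuclideanSpace.proj (𝕜 := ℝ) i : E3 →L[ℝ] ℝ).hasFDerivAt
  simp [pd, h.fderiv]

theorem contDiff_pd {F : E3 → ℝ} (hF : ContDiff ℝ (⊤ : ℕ∞) F) (i : Fin 3) :
    ContDiff ℝ (⊤ : ℕ∞) (pd F i) :=
  (hF.fderiv_right (m := (⊤ : ℕ∞)) (by simp)).clm_apply contDiff_const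

theorem norm_pd_le (F : E3 → ℝ) (i : Fin 3) (x : E3) : |pd F i x| ≤ ‖iteratedFDeriv ℝ 1 F x‖ := by
  rw [norm_iteratedFDeriv_one]
  simpa [pd] using (fderiv ℝ F x).le_opNorm (EuclideanSpace.single i 1)

theorem norm_pd_pd_le {F : E3 → ℝ} (hF : ContDiff ℝ (⊤ : ℕ∞) F) (i : Fin 3) (x : E3) :
    |pd (fun y => pd F i y) i x| ≤ ‖iteratedFDeriv ℝ 2 F x‖ := by
  have hd : DifferentiableAt ℝ (fderiv ℝ F) x :=
    ((hF.fderiv_right (m := (⊤ : ℕ∞)) (by simp)).differentiable (by simp)) x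
  have h : pd (fun y => pd F i y) i x
      = iteratedFDeriv ℝ 2 F x ![EuclideanSpace.single i 1, EuclideanSpace.single i 1] := by
    rw [iteratedFDeriv_two_apply]
    simp [pd, fderiv_clm_apply hd (differentiableAt_const _)]
  rw [h]
  simpa [Fin.prod_univ_two] using (iteratedFDeriv ℝ 2 F x).le_opNorm
    ![EuclideanSpace.single i 1, EuclideanSpace.single i 1]

theorem integral_pd_eq_zero {F : E3 → ℝ} (hF : Differentiable ℝ F) (hi : Integrable F) (i : Fin 3)
    (hi' : Integrable (pd F i)) : ∫ x, pd F i x = 0 := by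
  have h := integral_mul_fderiv_eq_neg_fderiv_mul_of_integrable (μ := (volume : Measure E3))
    (f := fun _ : E3 => (1 : ℝ)) (g := F) (v := EuclideanSpace.single i 1)
    (by simp) (by simp only [one_mul]; exact hi') (by simpa using hi)
    (fun _ _ => by fun_prop) (fun x _ => hF x)
  simpa [pd] using h

/-- The `i`-th component of the flux whose divergence is `2 f L f + 2 |∇f|² + f² / 2`. -/
def energyFlux (U : E3 → E3) (f : E3 → ℝ) (i : Fin 3) (x : E3) : ℝ :=
  2 * (f x * pd f i x) + ((1 / 2) * x i - U x i) * (f x * f x)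

section Flux

variable {U : E3 → E3} {f : E3 → ℝ}

theorem contDiff_component (hU : ContDiff ℝ (⊤ : ℕ∞) U) (i : Fin 3) :
    ContDiff ℝ (⊤ : ℕ∞) (fun x => U x i) :=
  (EuclideanSpace.proj (𝕜 := ℝ) i : E3 →L[ℝ] ℝ).contDiff.comp hU

theorem contDiff_coord (i : Fin 3) : ContDiff ℝ (⊤ : ℕ∞) (fun x : E3 => x i) :=
  contDiff_component contDiff_id i

theorem contDiff_energyFlux (hU : ContDiff ℝ (⊤ : ℕ∞) U) (hf : ContDiff ℝ (⊤ : ℕ∞) f)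
    (i : Fin 3) : ContDiff ℝ (⊤ : ℕ∞) (energyFlux U f i) :=
  (contDiff_const.mul (hf.mul (contDiff_pd hf i))).add
    (((contDiff_const.mul (contDiff_coord i)).sub (contDiff_component hU i)).mul (hf.mul hf))

theorem pd_energyFlux (hU : ContDiff ℝ (⊤ : ℕ∞) U) (hf : ContDiff ℝ (⊤ : ℕ∞) f)
    (i : Fin 3) (x : E3) :
    pd (energyFlux U f i) i x
      = 2 * (f x * pd (fun y => pd f i y) i x) + 2 * (pd f i x * pd f i x)
        + x i * (f x * pd f i x) + (-2) * (U x i * (f x * pd f i x))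
        + (1 / 2) * (f x * f x) + (-1) * (pd (fun y => U y i) i x * (f x * f x)) := by
  have h1 : DifferentiableAt ℝ f x := hf.differentiable (by simp) x
  have h2 : DifferentiableAt ℝ (fun y => pd f i y) x :=
    (contDiff_pd hf i).differentiable (by simp) x
  have h3 : DifferentiableAt ℝ (fun y => U y i) x :=
    (contDiff_component hU i).differentiable (by simp) x
  have h4 : DifferentiableAt ℝ (fun y : E3 => y i) x :=
    (contDiff_coord i).differentiable (by simp) x
  have h5 := h4.const_mul (1 / 2)
  have h6 := h1.fun_mul h2
  have h7 := h1.fun_mul h1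
  have h8 := h5.fun_sub h3
  unfold energyFlux
  rw [pd_add (h6.const_mul 2) (h8.fun_mul h7), pd_const_mul h6, pd_mul h1 h2, pd_mul h8 h7,
    pd_mul h1 h1,
    pd_sub h5 h3, pd_const_mul h4, pd_coord]
  ring

theorem two_mul_self_mul_Lgen_le (hU : ContDiff ℝ (⊤ : ℕ∞) U) (hdiv : ∀ x, divg U x = 0)
    (hf : ContDiff ℝ (⊤ : ℕ∞) f) (x : E3) :
    2 * (f x * Lgen U f x) ≤ (∑ i, pd (energyFlux U f i) i x) + (-1 / 2) * (f x * f x) := by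
  have hd := hdiv x
  simp only [divg, Fin.sum_univ_three] at hd
  simp only [pd_energyFlux hU hf, Lgen, lap, Fin.sum_univ_three]
  have e : pd (fun y => U y 2) 2 x = -pd (fun y => U y 0) 0 x - pd (fun y => U y 1) 1 x := by
    linarith
  rw [e]
  nlinarith [mul_self_nonneg (pd f 0 x), mul_self_nonneg (pd f 1 x), mul_self_nonneg (pd f 2 x)]

end Flux

theorem exists_bound_of_hasCompactSupport {g : E3 → ℝ} (hg : Continuous g)
    (hc : HasCompactSupport g) : ∃ B : ℝ, ∀ x, |g x| ≤ B :=
  hg.bounded_above_of_compact_support hc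

section Energy

variable {U : E3 → E3} {Θ : E3 → ℝ → ℝ}

theorem IsAdmissibleSS.contDiff_slice {I : Set ℝ} (hΘ : IsAdmissibleSS U I Θ) {t : ℝ}
    (ht : t ∈ I) : ContDiff ℝ (⊤ : ℕ∞) fun x => Θ x t :=
  hΘ.1.comp_contDiff (contDiff_id.prodMk contDiff_const) fun _ => ht

theorem IsAdmissibleSS.hasDerivAt (hΘ : IsAdmissibleSS U (Set.Ici 0) Θ) (x : E3) {t : ℝ}
    (ht : 0 < t) : HasDerivAt (fun s => Θ x s) (Lgen U (fun y => Θ y t) x) t := by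
  rw [← hΘ.2.1 x t ht.le]
  have hn : {q : E3 × ℝ | q.2 ∈ Set.Ici 0} ∈ nhds (x, t) :=
    continuous_snd.continuousAt.preimage_mem_nhds (Ici_mem_nhds ht)
  have hd : DifferentiableAt ℝ (fun q : E3 × ℝ => Θ q.1 q.2) (x, t) :=
    (hΘ.1.contDiffAt hn).differentiableAt (by simp)
  have hp : DifferentiableAt ℝ (fun s : ℝ => ((x, s) : E3 × ℝ)) t := by fun_prop
  exact (DifferentiableAt.comp t hd hp).hasDerivAt

theorem IsAdmissibleSS.continuousOn (hΘ : IsAdmissibleSS U (Set.Ici 0) Θ) (x : E3) :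
    ContinuousOn (fun s => Θ x s) (Set.Ici 0) :=
  hΘ.1.continuousOn.comp (f := fun s : ℝ => ((x, s) : E3 × ℝ)) (by fun_prop) fun _ hs => hs

theorem IsAdmissibleSS.rapidOn (hΘ : IsAdmissibleSS U (Set.Ici 0) Θ) (T : ℝ) (k : ℕ) :
    RapidOn (Set.Icc 0 T) fun x t => ‖iteratedFDeriv ℝ k (fun y => Θ y t) x‖ := by
  intro n
  obtain ⟨C, hC⟩ := hΘ.2.2 n k 0 T
  exact ⟨C, fun x t ht => by simpa using hC x t ht.1 ht.1 ht.2⟩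

theorem IsAdmissibleSS.rapidOn_self (hΘ : IsAdmissibleSS U (Set.Ici 0) Θ) (T : ℝ) :
    RapidOn (Set.Icc 0 T) Θ :=
  (hΘ.rapidOn T 0).of_abs_le fun x t _ => by simp

theorem IsAdmissibleSS.rapidOn_pd (hΘ : IsAdmissibleSS U (Set.Ici 0) Θ) (T : ℝ) (i : Fin 3) :
    RapidOn (Set.Icc 0 T) fun x t => pd (fun y => Θ y t) i x :=
  (hΘ.rapidOn T 1).of_abs_le fun x t _ => by simpa using norm_pd_le (fun y => Θ y t) i x

theorem IsAdmissibleSS.rapidOn_pd_pd (hΘ : IsAdmissibleSS U (Set.Ici 0) Θ) (T : ℝ) (i : Fin 3) :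
    RapidOn (Set.Icc 0 T) fun x t => pd (fun z => pd (fun y => Θ y t) i z) i x :=
  (hΘ.rapidOn T 2).of_abs_le fun x t ht => by
    simpa using norm_pd_pd_le (hΘ.contDiff_slice (Set.mem_Ici.2 ht.1)) i x

theorem exists_component_bound (hU : ContDiff ℝ (⊤ : ℕ∞) U) (hUc : HasCompactSupport U)
    (i : Fin 3) : ∃ B : ℝ, ∀ x, |U x i| ≤ B :=
  exists_bound_of_hasCompactSupport (contDiff_component hU i).continuous
    (hUc.comp_left (g := fun v : E3 => v i) rfl)

theorem exists_pd_component_bound (hU : ContDiff ℝ (⊤ : ℕ∞) U) (hUc : HasCompactSupport U)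
    (i : Fin 3) : ∃ B : ℝ, ∀ x, |pd (fun y => U y i) i x| ≤ B :=
  exists_bound_of_hasCompactSupport (contDiff_pd (contDiff_component hU i) i).continuous
    ((hUc.comp_left (g := fun v : E3 => v i) rfl).fderiv_apply (𝕜 := ℝ) _)

theorem IsAdmissibleSS.rapidOn_Lgen (hU : ContDiff ℝ (⊤ : ℕ∞) U) (hUc : HasCompactSupport U)
    (hΘ : IsAdmissibleSS U (Set.Ici 0) Θ) (T : ℝ) :
    RapidOn (Set.Icc 0 T) fun x t => Lgen U (fun y => Θ y t) x := by
  have hd := RapidOn.sum fun i => by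
    obtain ⟨B, hB⟩ := exists_component_bound hU hUc i
    exact (hΘ.rapidOn_pd T i).bdd_mul (G := fun x _ => U x i) fun x _ _ => hB x
  refine ((((RapidOn.sum (hΘ.rapidOn_pd_pd T)).add ((hΘ.rapidOn_self T).const_mul (1 / 2))).add
    ((RapidOn.sum fun i => (hΘ.rapidOn_pd T i).coord_mul i).const_mul (1 / 2))).add
    (hd.const_mul (-1))).of_abs_le fun x t _ => le_of_eq ?_
  simp only [Lgen, lap]
  congr 1
  ring

theorem IsAdmissibleSS.rapidOn_energyFlux (hU : ContDiff ℝ (⊤ : ℕ∞) U)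
    (hUc : HasCompactSupport U) (hΘ : IsAdmissibleSS U (Set.Ici 0) Θ) (T : ℝ) (i : Fin 3) :
    RapidOn (Set.Icc 0 T) fun x t => energyFlux U (fun y => Θ y t) i x := by
  obtain ⟨B, hB⟩ := exists_component_bound hU hUc i
  have h0 := hΘ.rapidOn_self T
  have hsq := h0.mul h0
  refine ((((h0.mul (hΘ.rapidOn_pd T i)).const_mul 2).add ((hsq.coord_mul i).const_mul (1 / 2))).add
    ((hsq.bdd_mul (G := fun x _ => U x i) fun x _ _ => hB x).const_mul (-1))).of_abs_le
    fun x t _ => le_of_eq ?_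
  simp only [energyFlux]
  congr 1
  ring

theorem IsAdmissibleSS.rapidOn_pd_energyFlux (hU : ContDiff ℝ (⊤ : ℕ∞) U)
    (hUc : HasCompactSupport U) (hΘ : IsAdmissibleSS U (Set.Ici 0) Θ) (T : ℝ) (i : Fin 3) :
    RapidOn (Set.Icc 0 T) fun x t => pd (energyFlux U (fun y => Θ y t) i) i x := by
  obtain ⟨B, hB⟩ := exists_component_bound hU hUc i
  obtain ⟨D, hD⟩ := exists_pd_component_bound hU hUc i
  have h0 := hΘ.rapidOn_self T
  have h1 := hΘ.rapidOn_pd T i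
  have h01 := h0.mul h1
  have hsq := h0.mul h0
  refine (((((((h0.mul (hΘ.rapidOn_pd_pd T i)).const_mul 2).add ((h1.mul h1).const_mul 2)).add
    (h01.coord_mul i)).add
    ((h01.bdd_mul (G := fun x _ => U x i) fun x _ _ => hB x).const_mul (-2))).add
    (hsq.const_mul (1 / 2))).add
    ((hsq.bdd_mul (G := fun x _ => pd (fun y => U y i) i x) fun x _ _ => hD x).const_mul
      (-1))).of_abs_le fun x t ht => le_of_eq ?_
  rw [pd_energyFlux hU (hΘ.contDiff_slice (Set.mem_Ici.2 ht.1))]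

theorem continuous_Lgen (hU : ContDiff ℝ (⊤ : ℕ∞) U) {f : E3 → ℝ}
    (hf : ContDiff ℝ (⊤ : ℕ∞) f) : Continuous (Lgen U f) :=
  (((continuous_finsetSum _ fun i _ => (contDiff_pd (contDiff_pd hf i) i).continuous).add
    (continuous_const.mul hf.continuous)).add (continuous_const.mul
      (continuous_finsetSum _ fun i _ =>
        (contDiff_coord i).continuous.mul (contDiff_pd hf i).continuous))).sub
    (continuous_finsetSum _ fun i _ =>
      (contDiff_component hU i).continuous.mul (contDiff_pd hf i).continuous)

theorem IsAdmissibleSS.integrable_sq (hΘ : IsAdmissibleSS U (Set.Ici 0) Θ) {t : ℝ} (ht : 0 ≤ t) :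
    Integrable fun x => Θ x t * Θ x t := by
  have hc := (hΘ.contDiff_slice (Set.mem_Ici.2 ht)).continuous
  exact ((hΘ.rapidOn_self t).mul (hΘ.rapidOn_self t)).integrable ⟨ht, le_rfl⟩ (hc.mul hc)

theorem IsAdmissibleSS.integral_self_mul_Lgen_le (hU : ContDiff ℝ (⊤ : ℕ∞) U)
    (hUc : HasCompactSupport U) (hdiv : ∀ x, divg U x = 0)
    (hΘ : IsAdmissibleSS U (Set.Ici 0) Θ) {t : ℝ} (ht : 0 ≤ t) :
    ∫ x, 2 * (Θ x t * Lgen U (fun y => Θ y t) x) ≤ (-1 / 2) * ∫ x, Θ x t * Θ x t := by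
  have hf := hΘ.contDiff_slice (Set.mem_Ici.2 ht)
  have hmem : t ∈ Set.Icc 0 t := ⟨ht, le_rfl⟩
  have hL : Integrable fun x => 2 * (Θ x t * Lgen U (fun y => Θ y t) x) :=
    (((hΘ.rapidOn_self t).mul (hΘ.rapidOn_Lgen hU hUc t)).const_mul 2).integrable hmem
      (continuous_const.mul (hf.continuous.mul (continuous_Lgen hU hf)))
  have hV (i : Fin 3) : Integrable (pd (energyFlux U (fun y => Θ y t) i) i) :=
    (hΘ.rapidOn_pd_energyFlux hU hUc t i).integrable hmem
      (contDiff_pd (contDiff_energyFlux hU hf i) i).continuous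
  have hS : Integrable fun x => ∑ i, pd (energyFlux U (fun y => Θ y t) i) i x :=
    integrable_finsetSum _ fun i _ => hV i
  have hQ := (hΘ.integrable_sq ht).const_mul (-1 / 2)
  have hzero : ∫ x, ∑ i, pd (energyFlux U (fun y => Θ y t) i) i x = 0 := by
    rw [integral_finsetSum _ fun i _ => hV i]
    refine Finset.sum_eq_zero fun i _ => ?_
    have hE := contDiff_energyFlux hU hf i
    exact integral_pd_eq_zero (hE.differentiable (by simp))
      ((hΘ.rapidOn_energyFlux hU hUc t i).integrable hmem hE.continuous) i (hV i)
  calc ∫ x, 2 * (Θ x t * Lgen U (fun y => Θ y t) x)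
      ≤ ∫ x, ((∑ i, pd (energyFlux U (fun y => Θ y t) i) i x) + (-1 / 2) * (Θ x t * Θ x t)) :=
        integral_mono hL (hS.add hQ) fun x => two_mul_self_mul_Lgen_le hU hdiv hf x
    _ = (-1 / 2) * ∫ x, Θ x t * Θ x t := by
        rw [integral_add hS hQ, hzero, integral_const_mul, zero_add]

theorem IsAdmissibleSS.hasDerivAt_integral_sq (hU : ContDiff ℝ (⊤ : ℕ∞) U)
    (hUc : HasCompactSupport U) (hΘ : IsAdmissibleSS U (Set.Ici 0) Θ) {t : ℝ} (ht : 0 < t) :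
    HasDerivAt (fun s => ∫ x, Θ x s * Θ x s)
      (∫ x, 2 * (Θ x t * Lgen U (fun y => Θ y t) x)) t := by
  obtain ⟨b, hb, hbound⟩ := (((hΘ.rapidOn_self (t + 1)).mul
    (hΘ.rapidOn_Lgen hU hUc (t + 1))).const_mul 2).exists_integrable_bound
  have hf := hΘ.contDiff_slice (Set.mem_Ici.2 ht.le)
  refine (hasDerivAt_integral_of_dominated_loc_of_deriv_le (s := Set.Ioo 0 (t + 1))
    (F := fun s x => Θ x s * Θ x s) (F' := fun s x => 2 * (Θ x s * Lgen U (fun y => Θ y s) x))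
    (bound := b) (Ioo_mem_nhds ht (by linarith)) ?_ (hΘ.integrable_sq ht.le)
    (continuous_const.mul (hf.continuous.mul (continuous_Lgen hU hf))).aestronglyMeasurable
    (.of_forall fun x s hs => hbound x s ⟨hs.1.le, hs.2.le⟩) hb
    (.of_forall fun x s hs => ?_)).2
  · filter_upwards [Ioi_mem_nhds ht] with s hs
    exact (hΘ.integrable_sq (le_of_lt hs)).aestronglyMeasurable
  · have h := hΘ.hasDerivAt x hs.1
    exact (h.fun_mul h).congr_deriv (by ring)

theorem IsAdmissibleSS.continuousOn_integral_sq (hΘ : IsAdmissibleSS U (Set.Ici 0) Θ) (T : ℝ) :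
    ContinuousOn (fun s => ∫ x, Θ x s * Θ x s) (Set.Icc 0 T) := by
  obtain ⟨b, hb, hbound⟩ :=
    ((hΘ.rapidOn_self T).mul (hΘ.rapidOn_self T)).exists_integrable_bound
  refine continuousOn_of_dominated (fun s hs => (hΘ.integrable_sq hs.1).aestronglyMeasurable)
    (fun s hs => .of_forall fun x => hbound x s hs) hb (.of_forall fun x => ?_)
  have h := (hΘ.continuousOn x).mono (Set.Icc_subset_Ici_self : Set.Icc 0 T ⊆ _)
  exact h.mul h

theorem IsAdmissibleSS.integral_sq_le (hU : ContDiff ℝ (⊤ : ℕ∞) U)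
    (hUc : HasCompactSupport U) (hdiv : ∀ x, divg U x = 0)
    (hΘ : IsAdmissibleSS U (Set.Ici 0) Θ) {T : ℝ} (hT : 0 ≤ T) :
    ∫ x, Θ x T * Θ x T ≤ Real.exp (-T / 2) * ∫ x, Θ x 0 * Θ x 0 := by
  have hexp (s : ℝ) : HasDerivAt (fun s : ℝ => Real.exp (s / 2)) (Real.exp (s / 2) * (1 / 2)) s :=
    ((hasDerivAt_id s).div_const 2).exp
  have hder (s : ℝ) (hs : 0 < s) := (hexp s).mul (hΘ.hasDerivAt_integral_sq hU hUc hs)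
  have hanti : AntitoneOn ((fun s : ℝ => Real.exp (s / 2)) * fun s => ∫ x, Θ x s * Θ x s)
      (Set.Icc 0 T) := by
    refine antitoneOn_of_deriv_nonpos (convex_Icc 0 T)
      ((by fun_prop : Continuous fun s : ℝ => Real.exp (s / 2)).continuousOn.mul
        (hΘ.continuousOn_integral_sq T)) ?_ ?_
    · rw [interior_Icc]
      exact fun s hs => (hder s hs.1).differentiableAt.differentiableWithinAt
    · rw [interior_Icc]
      intro s hs
      rw [(hder s hs.1).deriv]
      have h := mul_le_mul_of_nonneg_left (hΘ.integral_self_mul_Lgen_le hU hUc hdiv hs.1.le)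
        (Real.exp_pos (s / 2)).le
      linarith
  have h := hanti ⟨le_rfl, hT⟩ ⟨hT, le_rfl⟩ hT
  simp only [Pi.mul_apply, zero_div, Real.exp_zero, one_mul] at h
  calc ∫ x, Θ x T * Θ x T
      = Real.exp (-T / 2) * (Real.exp (T / 2) * ∫ x, Θ x T * Θ x T) := by
        rw [← mul_assoc, ← Real.exp_add, neg_div, neg_add_cancel, Real.exp_zero, one_mul]
    _ ≤ Real.exp (-T / 2) * ∫ x, Θ x 0 * Θ x 0 := by gcongr

theorem IsAdmissibleSS.eLpNorm_eq (hΘ : IsAdmissibleSS U (Set.Ici 0) Θ) {t : ℝ} (ht : 0 ≤ t) :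
    eLpNorm (fun x => Θ x t) 2 volume = ENNReal.ofReal √(∫ x, Θ x t * Θ x t) := by
  have hc := (hΘ.contDiff_slice (Set.mem_Ici.2 ht)).continuous
  have hm : MemLp (fun x => Θ x t) 2 volume := by
    rw [memLp_two_iff_integrable_sq hc.aestronglyMeasurable]
    simpa only [sq] using hΘ.integrable_sq ht
  rw [hm.eLpNorm_eq_integral_rpow_norm two_ne_zero ENNReal.ofNat_ne_top, Real.sqrt_eq_rpow]
  simp [sq]

end Energy

/-- **Exponential `L²` decay for the drift–diffusion semigroup in self-similar variables.**
If `Ū ∈ C_c^∞` is divergence-free and `Θ` is an admissible solution on `[0,∞)` of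
`∂_τΘ = ΔΘ + ½Θ + ½ξ·∇Θ − Ū·∇Θ`, then `‖Θ(τ)‖_{L²} ≤ e^{−τ/4} ‖Θ(0)‖_{L²}` for all
`τ ≥ 0`. -/
theorem selfSimilar_drift_diffusion_L2_decay
    (Ubar : E3 → E3) (hU : ContDiff ℝ (⊤ : ℕ∞) Ubar) (hUc : HasCompactSupport Ubar)
    (hUdiv : ∀ x, divg Ubar x = 0)
    (Θ : E3 → ℝ → ℝ) (hΘ : IsAdmissibleSS Ubar (Set.Ici 0) Θ) :
    ∀ τ : ℝ, 0 ≤ τ →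
      eLpNorm (fun ξ => Θ ξ τ) 2 volume
        ≤ ENNReal.ofReal (Real.exp (-τ / 4)) * eLpNorm (fun ξ => Θ ξ 0) 2 volume := by
  intro τ hτ
  rw [hΘ.eLpNorm_eq hτ, hΘ.eLpNorm_eq le_rfl, ← ENNReal.ofReal_mul (Real.exp_pos _).le]
  refine ENNReal.ofReal_le_ofReal ?_
  have he : Real.exp (-τ / 4) = √(Real.exp (-τ / 2)) := by
    rw [← Real.exp_half]
    congr 1
    ring
  rw [he, ← Real.sqrt_mul (Real.exp_pos _).le]
  exact Real.sqrt_le_sqrt (hΘ.integral_sq_le hU hUc hUdiv hτ)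
end
end

section
/- Let Ū ∈ C_c^∞(ℝ³;ℝ³) be divergence-free, set ū(x,t) := t^{-1/2}·Ū(x/√t), and let θ be an admissible solution on [1,∞) of ∂ₜθ = Δθ − ū·∇θ. Then for every integer k ≥ 1 there exists a constant C = C(k, Ū) such that for all t > 1: ∫₁^t ‖∇^k θ(·,s)‖²_{L²(ℝ³)} ds ≤ C·‖θ(·,1)‖²_{H^{k−1}}. -/
noncomputable section

open MeasureTheory
open scoped ENNReal BigOperators

/-- The self-similar velocity field `ū(x,t) = t^{-1/2} Ū(x/√t)`. -/
noncomputable def ubar (Ubar : E3 → E3) (x : E3) (t : ℝ) : E3 :=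
  (t ^ (-(1:ℝ)/2)) • Ubar ((t ^ (-(1:ℝ)/2)) • x)

/-- `θ` is an admissible solution on `ℝ³ × [1,∞)` of the advected heat equation
`∂ₜθ = Δθ − ū·∇θ`: it is smooth, solves the equation pointwise, and together with all
its spatial derivatives decays in `x` faster than any polynomial, locally uniformly
in `t`. -/
def IsAdmissible (Ubar : E3 → E3) (θ : E3 → ℝ → ℝ) : Prop :=
  ContDiffOn ℝ (⊤ : ℕ∞) (fun q : E3 × ℝ => θ q.1 q.2) {q : E3 × ℝ | 1 ≤ q.2} ∧
  (∀ (x : E3) (t : ℝ), 1 ≤ t →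
    deriv (fun s => θ x s) t
      = lap (fun y => θ y t) x - ∑ i, ubar Ubar x t i * pd (fun y => θ y t) i x) ∧
  (∀ (n k : ℕ) (T : ℝ), ∃ C : ℝ, ∀ (x : E3) (t : ℝ), 1 ≤ t → t ≤ T →
    ‖x‖ ^ n * ‖iteratedFDeriv ℝ k (fun y => θ y t) x‖ ≤ C)

/-- The unit vector `eᵢ` of `ℝ³`. -/
def stdVec (i : Fin 3) : E3 := EuclideanSpace.single i 1

lemma norm_stdVec (i : Fin 3) : ‖stdVec i‖ = 1 := by simp [stdVec]

/-- The space-time region `ℝ³ × [1,∞)`. -/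
def slab : Set (E3 × ℝ) := {q | 1 ≤ q.2}

/-- Spatial partial derivative of a space-time function. -/
def pdx (i : Fin 3) (F : E3 → ℝ → ℝ) (x : E3) (t : ℝ) : ℝ := pd (fun y => F y t) i x

/-- Joint smoothness on `ℝ³ × [1,∞)`. -/
def SmoothSlab (F : E3 → ℝ → ℝ) : Prop :=
  ContDiffOn ℝ (⊤ : ℕ∞) (fun q : E3 × ℝ => F q.1 q.2) slab

/-- All spatial derivatives are bounded, locally uniformly in time. -/
def BoundedJets (F : E3 → ℝ → ℝ) : Prop :=
  ∀ (k : ℕ) (T : ℝ), ∃ C : ℝ, ∀ (x : E3) (t : ℝ), 1 ≤ t → t ≤ T →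
    ‖iteratedFDeriv ℝ k (fun y => F y t) x‖ ≤ C

/-- All spatial derivatives decay rapidly, locally uniformly in time. -/
def RapidDecay (F : E3 → ℝ → ℝ) : Prop :=
  ∀ (n k : ℕ) (T : ℝ), ∃ C : ℝ, ∀ (x : E3) (t : ℝ), 1 ≤ t → t ≤ T →
    ‖x‖ ^ n * ‖iteratedFDeriv ℝ k (fun y => F y t) x‖ ≤ C

lemma convex_slab : Convex ℝ slab :=
  convex_halfSpace_ge (LinearMap.isLinear (LinearMap.snd ℝ E3 ℝ)) 1

lemma mem_nhds_slab {x : E3} {t : ℝ} (ht : 1 < t) : slab ∈ nhds (x, t) := by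
  have : IsOpen {q : E3 × ℝ | 1 < q.2} := isOpen_lt continuous_const continuous_snd
  exact Filter.mem_of_superset (this.mem_nhds ht) fun q (hq : 1 < q.2) => hq.le

lemma uniqueDiffOn_slab : UniqueDiffOn ℝ slab :=
  uniqueDiffOn_convex convex_slab
    ⟨((0 : E3), (2 : ℝ)), mem_interior_iff_mem_nhds.2 (mem_nhds_slab (by norm_num))⟩

lemma contDiff_slice_map (t : ℝ) : ContDiff ℝ (⊤ : ℕ∞) fun y : E3 => (y, t) :=
  contDiff_id.prodMk contDiff_const

namespace SmoothSlab

variable {F G : E3 → ℝ → ℝ}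

lemma slice (hF : SmoothSlab F) {t : ℝ} (ht : 1 ≤ t) :
    ContDiff ℝ (⊤ : ℕ∞) fun y => F y t := by
  rw [← contDiffOn_univ]
  exact ContDiffOn.comp (g := fun q : E3 × ℝ => F q.1 q.2) (f := fun y : E3 => (y, t)) hF
    (contDiff_slice_map t).contDiffOn fun _ _ => ht

lemma contDiffAt (hF : SmoothSlab F) (x : E3) {t : ℝ} (ht : 1 < t) :
    ContDiffAt ℝ (⊤ : ℕ∞) (fun q : E3 × ℝ => F q.1 q.2) (x, t) :=
  ContDiffOn.contDiffAt hF (mem_nhds_slab ht)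

lemma pdx_eq (hF : SmoothSlab F) (i : Fin 3) (x : E3) {t : ℝ} (ht : 1 ≤ t) :
    pdx i F x t = fderivWithin ℝ (fun q : E3 × ℝ => F q.1 q.2) slab (x, t) (stdVec i, 0) := by
  have h1 : HasFDerivWithinAt (fun q : E3 × ℝ => F q.1 q.2)
      (fderivWithin ℝ (fun q : E3 × ℝ => F q.1 q.2) slab (x, t)) slab (x, t) :=
    (ContDiffOn.differentiableOn hF (by simp) (x, t) ht).hasFDerivWithinAt
  have h2 : HasFDerivWithinAt (fun y : E3 => (y, t))
      ((ContinuousLinearMap.id ℝ E3).prod 0) Set.univ x :=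
    ((hasFDerivAt_id x).prodMk (hasFDerivAt_const t x)).hasFDerivWithinAt
  have h3 := (h1.comp x h2 fun _ _ => ht).hasFDerivAt Filter.univ_mem
  have h4 : fderiv ℝ (fun y => F y t) x = _ := h3.fderiv
  simp only [pdx, pd, h4]
  simp [stdVec]

lemma pdx (hF : SmoothSlab F) (i : Fin 3) : SmoothSlab (pdx i F) := by
  have h : ContDiffOn ℝ (⊤ : ℕ∞)
      (fderivWithin ℝ (fun q : E3 × ℝ => F q.1 q.2) slab) slab :=
    ContDiffOn.fderivWithin hF uniqueDiffOn_slab (by simp)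
  exact (h.clm_apply contDiffOn_const).congr fun q hq => hF.pdx_eq i q.1 hq

lemma mul (hF : SmoothSlab F) (hG : SmoothSlab G) : SmoothSlab fun x t => F x t * G x t :=
  ContDiffOn.mul hF hG

lemma sub (hF : SmoothSlab F) (hG : SmoothSlab G) : SmoothSlab fun x t => F x t - G x t :=
  ContDiffOn.sub hF hG

lemma sum {ι : Type*} {s : Finset ι} {F : ι → E3 → ℝ → ℝ} (hF : ∀ i ∈ s, SmoothSlab (F i)) :
    SmoothSlab fun x t => ∑ i ∈ s, F i x t :=
  ContDiffOn.sum fun i hi => hF i hi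

lemma continuousOn_time (hF : SmoothSlab F) (x : E3) : ContinuousOn (F x) (Set.Ici 1) :=
  (ContDiffOn.continuousOn hF).comp (f := fun t : ℝ => (x, t)) (by fun_prop) fun _ ht => ht

lemma hasDerivAt_time (hF : SmoothSlab F) (x : E3) {t : ℝ} (ht : 1 < t) :
    HasDerivAt (F x) (fderiv ℝ (fun q : E3 × ℝ => F q.1 q.2) (x, t) (0, 1)) t := by
  have h1 := ((hF.contDiffAt x ht).differentiableAt (by simp)).hasFDerivAt
  have h2 : HasDerivAt (fun s : ℝ => (x, s)) ((0 : E3), (1 : ℝ)) t :=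
    (hasDerivAt_const t x).prodMk (hasDerivAt_id t)
  exact h1.comp_hasDerivAt t h2

end SmoothSlab

/-- Time and space derivatives of a smooth function commute. -/
lemma hasDerivAt_pdx {F G : E3 → ℝ → ℝ} (hF : SmoothSlab F)
    (h : ∀ (x : E3) (t : ℝ), 1 < t → HasDerivAt (F x) (G x t) t) (i : Fin 3) (x : E3) {t : ℝ}
    (ht : 1 < t) : HasDerivAt (pdx i F x) (pdx i G x t) t := by
  set Φ : E3 × ℝ → ℝ := fun q => F q.1 q.2
  have hsm : ContDiffAt ℝ (⊤ : ℕ∞) Φ (x, t) := hF.contDiffAt x ht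
  have hd : ContDiffAt ℝ (⊤ : ℕ∞) (fderiv ℝ Φ) (x, t) := hsm.fderiv_right (by simp)
  have hdd := (hd.differentiableAt (by simp)).hasFDerivAt
  have hGeq : (fun y => G y t) = fun y => fderiv ℝ Φ (y, t) (0, 1) := by
    funext y
    exact (h y t ht).unique (hF.hasDerivAt_time y ht)
  have hFeq : pdx i F x =ᶠ[nhds t] fun s => fderiv ℝ Φ (x, s) (stdVec i, 0) := by
    filter_upwards [lt_mem_nhds ht] with s hs
    rw [hF.pdx_eq i x hs.le, fderivWithin_of_mem_nhds (mem_nhds_slab hs)]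
  have hsym : IsSymmSndFDerivAt ℝ Φ (x, t) :=
    hsm.isSymmSndFDerivAt (by simpa using WithTop.coe_le_coe.2 (le_top : (2 : ℕ∞) ≤ ⊤))
  have h1 : HasDerivAt (fun s => fderiv ℝ Φ (x, s) (stdVec i, 0))
      (fderiv ℝ (fderiv ℝ Φ) (x, t) (0, 1) (stdVec i, 0)) t := by
    have h2 : HasDerivAt (fun s : ℝ => (x, s)) ((0 : E3), (1 : ℝ)) t :=
      (hasDerivAt_const t x).prodMk (hasDerivAt_id t)
    have h3 := hdd.comp_hasDerivAt t h2
    simpa using h3.clm_apply (hasDerivAt_const t ((stdVec i, 0) : E3 × ℝ))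
  have h2 : pdx i G x t = fderiv ℝ (fderiv ℝ Φ) (x, t) (stdVec i, 0) (0, 1) := by
    have h4 : HasFDerivAt (fun y : E3 => (y, t)) ((ContinuousLinearMap.id ℝ E3).prod 0) x :=
      (hasFDerivAt_id x).prodMk (hasFDerivAt_const t x)
    have h5 := (hdd.comp x h4).clm_apply (hasFDerivAt_const ((0, 1) : E3 × ℝ) x)
    have h6 : fderiv ℝ (fun y => fderiv ℝ Φ (y, t) (0, 1)) x = _ := h5.fderiv
    simp only [pdx, hGeq, pd, h6]
    simp [stdVec]
  rw [h2, hsym.eq]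
  exact h1.congr_of_eventuallyEq hFeq

lemma pdx_comm {F : E3 → ℝ → ℝ} (hF : SmoothSlab F) (i j : Fin 3) (x : E3) {t : ℝ}
    (ht : 1 ≤ t) : pdx i (pdx j F) x t = pdx j (pdx i F) x t := by
  have hs := hF.slice ht
  have hd : ContDiff ℝ (⊤ : ℕ∞) (fderiv ℝ fun y => F y t) := hs.fderiv_right (by simp)
  have key : ∀ a b : Fin 3, pdx a (pdx b F) x t
      = fderiv ℝ (fderiv ℝ fun y => F y t) x (stdVec a) (stdVec b) := by
    intro a b
    have h5 := ((hd.differentiable (by simp)) x).hasFDerivAt.clm_apply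
      (hasFDerivAt_const (stdVec b) x)
    have h6 : fderiv ℝ (fun y => fderiv ℝ (fun y => F y t) y (stdVec b)) x = _ := h5.fderiv
    change fderiv ℝ (fun y => fderiv ℝ (fun y => F y t) y (stdVec b)) x (stdVec a) = _
    rw [h6]
    simp
  rw [key, key]
  exact (hs.contDiffAt.isSymmSndFDerivAt
    (by simpa using WithTop.coe_le_coe.2 (le_top : (2 : ℕ∞) ≤ ⊤))).eq _ _

lemma pdx_sum {ι : Type*} {s : Finset ι} {F : ι → E3 → ℝ → ℝ} (hF : ∀ j ∈ s, SmoothSlab (F j))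
    (i : Fin 3) (x : E3) {t : ℝ} (ht : 1 ≤ t) :
    pdx i (fun x t => ∑ j ∈ s, F j x t) x t = ∑ j ∈ s, pdx i (F j) x t := by
  have h := HasFDerivAt.fun_sum (u := s) (A := fun j y => F j y t) (x := x) fun j hj =>
    (((hF j hj).slice ht).differentiable (by simp) x).hasFDerivAt
  simp only [pdx, pd]
  rw [h.fderiv]
  simp

lemma pdx_sub {F G : E3 → ℝ → ℝ} (hF : SmoothSlab F) (hG : SmoothSlab G)
    (i : Fin 3) (x : E3) {t : ℝ} (ht : 1 ≤ t) :
    pdx i (fun x t => F x t - G x t) x t = pdx i F x t - pdx i G x t := by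
  have h := ((hF.slice ht).differentiable (by simp) x).hasFDerivAt.fun_sub
    ((hG.slice ht).differentiable (by simp) x).hasFDerivAt
  simp only [pdx, pd]
  rw [h.fderiv]
  simp

lemma pdx_mul {F G : E3 → ℝ → ℝ} (hF : SmoothSlab F) (hG : SmoothSlab G)
    (i : Fin 3) (x : E3) {t : ℝ} (ht : 1 ≤ t) :
    pdx i (fun x t => F x t * G x t) x t = pdx i F x t * G x t + F x t * pdx i G x t := by
  have h := ((hF.slice ht).differentiable (by simp) x).hasFDerivAt.fun_mul
    ((hG.slice ht).differentiable (by simp) x).hasFDerivAt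
  simp only [pdx, pd]
  rw [h.fderiv]
  simp
  ring

lemma norm_iteratedFDeriv_pdx_le {F : E3 → ℝ → ℝ} (hF : SmoothSlab F) (i : Fin 3) (k : ℕ)
    (x : E3) {t : ℝ} (ht : 1 ≤ t) :
    ‖iteratedFDeriv ℝ k (fun y => pdx i F y t) x‖
      ≤ ‖iteratedFDeriv ℝ (k + 1) (fun y => F y t) x‖ := by
  have hd : ContDiff ℝ (⊤ : ℕ∞) (fderiv ℝ fun y => F y t) :=
    (hF.slice ht).fderiv_right (by simp)
  have h := norm_iteratedFDeriv_clm_apply_const (c := stdVec i) (x := x) (n := k)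
    hd.contDiffAt (by exact_mod_cast le_top)
  rwa [norm_stdVec, one_mul, norm_iteratedFDeriv_fderiv] at h

namespace RapidDecay

variable {F G : E3 → ℝ → ℝ}

lemma pdx (hF : RapidDecay F) (hs : SmoothSlab F) (i : Fin 3) : RapidDecay (pdx i F) := by
  intro n k T
  obtain ⟨C, hC⟩ := hF n (k + 1) T
  refine ⟨C, fun x t h1 h2 => le_trans ?_ (hC x t h1 h2)⟩
  gcongr
  exact norm_iteratedFDeriv_pdx_le hs i k x h1

lemma boundedJets (hF : RapidDecay F) : BoundedJets F := fun k T => by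
  simpa using hF 0 k T

lemma sub (hF : RapidDecay F) (hG : RapidDecay G) (hsF : SmoothSlab F) (hsG : SmoothSlab G) :
    RapidDecay fun x t => F x t - G x t := by
  intro n k T
  obtain ⟨C, hC⟩ := hF n k T
  obtain ⟨D, hD⟩ := hG n k T
  refine ⟨C + D, fun x t h1 h2 => le_trans ?_ (add_le_add (hC x t h1 h2) (hD x t h1 h2))⟩
  have h : iteratedFDeriv ℝ k (fun y => F y t - G y t) x
      = iteratedFDeriv ℝ k (fun y => F y t) x - iteratedFDeriv ℝ k (fun y => G y t) x :=
    iteratedFDeriv_sub_apply ((hsF.slice h1).contDiffAt.of_le (by exact_mod_cast le_top))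
      ((hsG.slice h1).contDiffAt.of_le (by exact_mod_cast le_top))
  rw [h, ← mul_add]
  gcongr
  exact norm_sub_le _ _

lemma sum {ι : Type*} {s : Finset ι} {F : ι → E3 → ℝ → ℝ} (hs : ∀ i ∈ s, SmoothSlab (F i))
    (hF : ∀ i ∈ s, RapidDecay (F i)) : RapidDecay fun x t => ∑ i ∈ s, F i x t := by
  intro n k T
  have h' : ∀ i, ∃ C : ℝ, i ∈ s → ∀ (x : E3) (t : ℝ), 1 ≤ t → t ≤ T →
      ‖x‖ ^ n * ‖iteratedFDeriv ℝ k (fun y => F i y t) x‖ ≤ C := fun i => by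
    by_cases hi : i ∈ s
    · obtain ⟨C, hC⟩ := hF i hi n k T
      exact ⟨C, fun _ => hC⟩
    · exact ⟨0, fun h => absurd h hi⟩
  choose C hC using h'
  refine ⟨∑ i ∈ s, C i, fun x t h1 h2 => ?_⟩
  rw [iteratedFDeriv_sum fun i hi => ((hs i hi).slice h1).of_le (by exact_mod_cast le_top),
    Finset.sum_apply]
  calc ‖x‖ ^ n * ‖∑ i ∈ s, iteratedFDeriv ℝ k (fun y => F i y t) x‖
      ≤ ‖x‖ ^ n * ∑ i ∈ s, ‖iteratedFDeriv ℝ k (fun y => F i y t) x‖ := by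
        gcongr
        exact norm_sum_le _ _
    _ ≤ ∑ i ∈ s, C i := by
        rw [Finset.mul_sum]
        exact Finset.sum_le_sum fun i hi => hC i hi x t h1 h2

lemma bounded_mul (hF : BoundedJets F) (hG : RapidDecay G) (hsF : SmoothSlab F)
    (hsG : SmoothSlab G) : RapidDecay fun x t => F x t * G x t := by
  intro n k T
  choose C hC using fun i => hF i T
  choose D hD using fun i => hG n i T
  refine ⟨∑ i ∈ Finset.range (k + 1), (k.choose i : ℝ) * C i * D (k - i), fun x t h1 h2 => ?_⟩
  have h := norm_iteratedFDeriv_mul_le (hsF.slice h1) (hsG.slice h1) x (n := k)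
    (by exact_mod_cast le_top)
  calc ‖x‖ ^ n * ‖iteratedFDeriv ℝ k (fun y => F y t * G y t) x‖
      ≤ ‖x‖ ^ n * ∑ i ∈ Finset.range (k + 1), (k.choose i : ℝ) *
          ‖iteratedFDeriv ℝ i (fun y => F y t) x‖ *
          ‖iteratedFDeriv ℝ (k - i) (fun y => G y t) x‖ := by gcongr
    _ = ∑ i ∈ Finset.range (k + 1), (k.choose i : ℝ) * ‖iteratedFDeriv ℝ i (fun y => F y t) x‖ *
          (‖x‖ ^ n * ‖iteratedFDeriv ℝ (k - i) (fun y => G y t) x‖) := by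
        rw [Finset.mul_sum]
        exact Finset.sum_congr rfl fun i _ => by ring
    _ ≤ _ := by
        refine Finset.sum_le_sum fun i _ => ?_
        have h0 : 0 ≤ C i := (norm_nonneg _).trans (hC i x t h1 h2)
        gcongr
        · exact hC i x t h1 h2
        · exact hD (k - i) x t h1 h2

/-- Rapidly decaying functions are dominated by an integrable weight. -/
lemma exists_weight_bound (hF : RapidDecay F) (k : ℕ) (T : ℝ) :
    ∃ C : ℝ, ∀ (x : E3) (t : ℝ), 1 ≤ t → t ≤ T →
      ‖iteratedFDeriv ℝ k (fun y => F y t) x‖ ≤ C * (1 + ‖x‖) ^ (-(4 : ℝ)) := by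
  obtain ⟨C, hC⟩ := hF 0 k T
  obtain ⟨D, hD⟩ := hF 4 k T
  refine ⟨8 * (C + D), fun x t h1 h2 => ?_⟩
  have hpos : 0 < (1 + ‖x‖) ^ (4 : ℝ) := by positivity
  rw [Real.rpow_neg (by positivity), ← div_eq_mul_inv, le_div_iff₀ hpos]
  have h4 : (1 + ‖x‖) ^ (4 : ℝ) = (1 + ‖x‖) ^ 4 := by exact_mod_cast Real.rpow_natCast _ 4
  have hb : (1 + ‖x‖) ^ 4 ≤ 8 * (1 + ‖x‖ ^ 4) := by
    nlinarith [sq_nonneg (‖x‖ ^ 2 - 1), sq_nonneg (‖x‖ - 1), norm_nonneg x,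
      sq_nonneg (‖x‖ * (‖x‖ - 1)), sq_nonneg (‖x‖ ^ 2 - ‖x‖)]
  have e1 := hC x t h1 h2
  have e2 := hD x t h1 h2
  rw [h4]
  set N := ‖iteratedFDeriv ℝ k (fun y => F y t) x‖
  calc N * (1 + ‖x‖) ^ 4 ≤ N * (8 * (1 + ‖x‖ ^ 4)) := by gcongr
    _ = 8 * (‖x‖ ^ 0 * N + ‖x‖ ^ 4 * N) := by ring
    _ ≤ 8 * (C + D) := by gcongr

end RapidDecay

lemma integrable_weight : Integrable fun x : E3 => (1 + ‖x‖) ^ (-(4 : ℝ)) :=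
  integrable_one_add_norm (by simp; norm_num)

/-- Smooth on `ℝ³ × [1,∞)` with rapid spatial decay. -/
structure RapidSmooth (F : E3 → ℝ → ℝ) : Prop where
  smooth : SmoothSlab F
  decay : RapidDecay F

namespace RapidSmooth

variable {F G : E3 → ℝ → ℝ}

lemma pdx (hF : RapidSmooth F) (i : Fin 3) : RapidSmooth (pdx i F) :=
  ⟨hF.1.pdx i, hF.2.pdx hF.1 i⟩

lemma mul (hF : RapidSmooth F) (hG : RapidSmooth G) : RapidSmooth fun x t => F x t * G x t :=
  ⟨hF.1.mul hG.1, RapidDecay.bounded_mul hF.2.boundedJets hG.2 hF.1 hG.1⟩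

lemma sub (hF : RapidSmooth F) (hG : RapidSmooth G) : RapidSmooth fun x t => F x t - G x t :=
  ⟨hF.1.sub hG.1, hF.2.sub hG.2 hF.1 hG.1⟩

lemma sum {ι : Type*} {s : Finset ι} {F : ι → E3 → ℝ → ℝ} (hF : ∀ i ∈ s, RapidSmooth (F i)) :
    RapidSmooth fun x t => ∑ i ∈ s, F i x t :=
  ⟨SmoothSlab.sum fun i hi => (hF i hi).1,
    RapidDecay.sum (fun i hi => (hF i hi).1) fun i hi => (hF i hi).2⟩

lemma sq (hF : RapidSmooth F) : RapidSmooth fun x t => F x t ^ 2 := by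
  simpa only [pow_two] using hF.mul hF

lemma exists_bound (hF : RapidSmooth F) (T : ℝ) : ∃ C : ℝ, ∀ (x : E3) (t : ℝ), 1 ≤ t → t ≤ T →
    ‖F x t‖ ≤ C * (1 + ‖x‖) ^ (-(4 : ℝ)) := by
  simpa only [norm_iteratedFDeriv_zero] using hF.2.exists_weight_bound 0 T

lemma aestronglyMeasurable (hF : RapidSmooth F) {t : ℝ} (ht : 1 ≤ t) :
    AEStronglyMeasurable fun x => F x t :=
  (hF.1.slice ht).continuous.aestronglyMeasurable

lemma integrable (hF : RapidSmooth F) {t : ℝ} (ht : 1 ≤ t) : Integrable fun x => F x t := by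
  obtain ⟨C, hC⟩ := hF.exists_bound t
  exact (integrable_weight.const_mul C).mono' (hF.aestronglyMeasurable ht)
    (Filter.Eventually.of_forall fun x => hC x t ht le_rfl)

lemma continuousOn_integral (hF : RapidSmooth F) (T : ℝ) :
    ContinuousOn (fun t => ∫ x, F x t) (Set.Icc 1 T) := by
  obtain ⟨C, hC⟩ := hF.exists_bound T
  exact continuousOn_of_dominated (fun t ht => hF.aestronglyMeasurable ht.1)
    (fun t ht => Filter.Eventually.of_forall fun x => hC x t ht.1 ht.2)
    (integrable_weight.const_mul C)
    (Filter.Eventually.of_forall fun x =>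
      (hF.1.continuousOn_time x).mono Set.Icc_subset_Ici_self)

lemma intervalIntegrable (hF : RapidSmooth F) {T : ℝ} (hT : 1 ≤ T) :
    IntervalIntegrable (fun t => ∫ x, F x t) volume 1 T :=
  ContinuousOn.intervalIntegrable_of_Icc hT (hF.continuousOn_integral T)

lemma hasDerivAt_integral (hF : RapidSmooth F) (hG : RapidSmooth G)
    (h : ∀ (x : E3) (t : ℝ), 1 < t → HasDerivAt (F x) (G x t) t) {t : ℝ} (ht : 1 < t) :
    HasDerivAt (fun s => ∫ x, F x s) (∫ x, G x t) t := by
  obtain ⟨C, hC⟩ := hG.exists_bound (t + 1)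
  refine (hasDerivAt_integral_of_dominated_loc_of_deriv_le (F := fun s x => F x s)
    (F' := fun s x => G x s) (s := Set.Ioo 1 (t + 1))
    (bound := fun x => C * (1 + ‖x‖) ^ (-(4 : ℝ))) (Ioo_mem_nhds ht (by linarith)) ?_
    (hF.integrable ht.le) (hG.aestronglyMeasurable ht.le) ?_
    (integrable_weight.const_mul C) ?_).2
  · filter_upwards [lt_mem_nhds ht] with s hs using hF.aestronglyMeasurable hs.le
  · exact Filter.Eventually.of_forall fun x s hs => hC x s hs.1.le hs.2.le
  · exact Filter.Eventually.of_forall fun x s hs => h x s hs.1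

lemma integral_sub_eq (hF : RapidSmooth F) (hG : RapidSmooth G)
    (h : ∀ (x : E3) (t : ℝ), 1 < t → HasDerivAt (F x) (G x t) t) {t : ℝ} (ht : 1 < t) :
    ∫ s in (1 : ℝ)..t, ∫ x, G x s = (∫ x, F x t) - ∫ x, F x 1 :=
  intervalIntegral.integral_eq_sub_of_hasDerivAt_of_le ht.le (hF.continuousOn_integral t)
    (fun _ hs => hF.hasDerivAt_integral hG h hs.1) (hG.intervalIntegrable ht.le)

/-- Spatial integration by parts. -/
lemma integral_mul_pdx (hF : RapidSmooth F) (hG : RapidSmooth G) (i : Fin 3) {t : ℝ} (ht : 1 ≤ t) :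
    ∫ x, F x t * _root_.pdx i G x t = -∫ x, _root_.pdx i F x t * G x t :=
  integral_mul_fderiv_eq_neg_fderiv_mul_of_integrable (v := EuclideanSpace.single i 1)
    (((hF.pdx i).mul hG).integrable ht) ((hF.mul (hG.pdx i)).integrable ht)
    ((hF.mul hG).integrable ht)
    (fun x _ => (hF.1.slice ht).differentiable (by simp) x)
    (fun x _ => (hG.1.slice ht).differentiable (by simp) x)

end RapidSmooth

/-- `F` solves the forced heat equation `∂ₜF = ΔF − g` on `t > 1`. -/
structure HeatSol (F g : E3 → ℝ → ℝ) : Prop where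
  sol : RapidSmooth F
  force : RapidSmooth g
  eqn : ∀ (x : E3) (t : ℝ), 1 < t →
    HasDerivAt (F x) (∑ j, pdx j (pdx j F) x t - g x t) t

namespace HeatSol

variable {F g : E3 → ℝ → ℝ}

lemma pdx (h : HeatSol F g) (i : Fin 3) : HeatSol (pdx i F) (pdx i g) where
  sol := h.sol.pdx i
  force := h.force.pdx i
  eqn x t ht := by
    have hs : ∀ j ∈ Finset.univ, SmoothSlab (_root_.pdx j (_root_.pdx j F)) :=
      fun j _ => ((h.sol.pdx j).pdx j).1
    have key := hasDerivAt_pdx h.sol.1 h.eqn i x ht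
    have e : _root_.pdx i (fun x t => ∑ j, _root_.pdx j (_root_.pdx j F) x t - g x t) x t
        = ∑ j, _root_.pdx j (_root_.pdx j (_root_.pdx i F)) x t - _root_.pdx i g x t := by
      rw [pdx_sub (SmoothSlab.sum hs) h.force.1 i x ht.le, pdx_sum hs i x ht.le]
      congr 1
      refine Finset.sum_congr rfl fun j _ => ?_
      rw [pdx_comm (h.sol.pdx j).1 i j x ht.le]
      simp only [_root_.pdx, pd]
      congr 2
      funext y
      exact pdx_comm h.sol.1 i j y ht.le
    rwa [e] at key

lemma energy_eq (h : HeatSol F g) {t : ℝ} (ht : 1 < t) :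
    (∫ s in (1 : ℝ)..t, (-2 * (∑ j, ∫ x, _root_.pdx j F x s ^ 2) - 2 * ∫ x, F x s * g x s))
      = (∫ x, F x t ^ 2) - ∫ x, F x 1 ^ 2 := by
  have hL : ∀ j ∈ Finset.univ, RapidSmooth (_root_.pdx j (_root_.pdx j F)) :=
    fun j _ => (h.sol.pdx j).pdx j
  have hR := (RapidSmooth.sum hL).sub h.force
  have hFR := h.sol.mul hR
  have hder : ∀ (x : E3) (t : ℝ), 1 < t → HasDerivAt (fun s => F x s ^ 2)
      (F x t * (∑ j, _root_.pdx j (_root_.pdx j F) x t - g x t)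
        + F x t * (∑ j, _root_.pdx j (_root_.pdx j F) x t - g x t)) t := by
    intro x t ht
    refine ((h.eqn x t ht).fun_pow 2).congr_deriv ?_
    push_cast
    ring
  have hadd : RapidSmooth fun x t => F x t * (∑ j, _root_.pdx j (_root_.pdx j F) x t - g x t)
        + F x t * (∑ j, _root_.pdx j (_root_.pdx j F) x t - g x t) := by
    have := RapidSmooth.sum (s := (Finset.univ : Finset (Fin 2)))
      (F := fun _ x t => F x t * (∑ j, _root_.pdx j (_root_.pdx j F) x t - g x t))
      fun _ _ => hFR
    simpa only [Fin.sum_univ_two] using this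
  rw [← h.sol.sq.integral_sub_eq hadd hder ht]
  refine intervalIntegral.integral_congr fun s hs => ?_
  rw [Set.uIcc_of_le ht.le] at hs
  have hs1 := hs.1
  have hibp : ∀ j, ∫ x, F x s * _root_.pdx j (_root_.pdx j F) x s
      = -∫ x, _root_.pdx j F x s ^ 2 := by
    intro j
    rw [h.sol.integral_mul_pdx (h.sol.pdx j) j hs1]
    simp only [sq]
  have hI : ∫ x, F x s * (∑ j, _root_.pdx j (_root_.pdx j F) x s - g x s)
      = -(∑ j, ∫ x, _root_.pdx j F x s ^ 2) - ∫ x, F x s * g x s := by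
    simp only [mul_sub, Finset.mul_sum]
    rw [integral_sub
      (integrable_finsetSum _ fun j hj => (h.sol.mul (hL j hj)).integrable hs1)
      ((h.sol.mul h.force).integrable hs1),
      integral_finsetSum _ fun j hj => (h.sol.mul (hL j hj)).integrable hs1]
    simp only [hibp, Finset.sum_neg_distrib]
  rw [integral_add (hFR.integrable hs1) (hFR.integrable hs1), hI]
  ring

/-- Energy inequality when the forcing has vanishing work. -/
lemma energy_le_of_orthogonal (h : HeatSol F g)
    (horth : ∀ t, 1 ≤ t → ∫ x, F x t * g x t = 0) {t : ℝ} (ht : 1 < t) (i : Fin 3) :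
    ∫ s in (1 : ℝ)..t, ∫ x, _root_.pdx i F x s ^ 2 ≤ ∫ x, F x 1 ^ 2 := by
  have hii : ∀ j, IntervalIntegrable (fun s => ∫ x, _root_.pdx j F x s ^ 2) volume 1 t :=
    fun j => (h.sol.pdx j).sq.intervalIntegrable ht.le
  have he := h.energy_eq ht
  rw [intervalIntegral.integral_congr (g := fun s => -2 * ∑ j, ∫ x, _root_.pdx j F x s ^ 2)
    (fun s hs => by
      rw [Set.uIcc_of_le ht.le] at hs
      simp [horth s hs.1]), intervalIntegral.integral_const_mul,
    intervalIntegral.integral_finsetSum fun j _ => hii j] at he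
  have h0 : 0 ≤ ∫ x, F x t ^ 2 := integral_nonneg fun _ => sq_nonneg _
  have hpos : ∀ j, 0 ≤ ∫ s in (1 : ℝ)..t, ∫ x, _root_.pdx j F x s ^ 2 := fun j =>
    intervalIntegral.integral_nonneg ht.le fun _ _ => integral_nonneg fun _ => sq_nonneg _
  have hle := Finset.single_le_sum (fun j _ => hpos j) (Finset.mem_univ i)
  have := hpos i
  linarith

/-- Energy inequality for a spatial derivative of a solution: the forcing `∂ᵢg` is controlled
by `g` in `L²` at the cost of part of the dissipation. -/
lemma energy_le_pdx (h : HeatSol F g) (i j : Fin 3) {t : ℝ} (ht : 1 < t) :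
    ∫ s in (1 : ℝ)..t, ∫ x, _root_.pdx j (_root_.pdx i F) x s ^ 2
      ≤ (∫ x, _root_.pdx i F x 1 ^ 2) + ∫ s in (1 : ℝ)..t, ∫ x, g x s ^ 2 := by
  have hi := h.pdx i
  have hii : ∀ j, IntervalIntegrable
      (fun s => ∫ x, _root_.pdx j (_root_.pdx i F) x s ^ 2) volume 1 t :=
    fun j => (hi.sol.pdx j).sq.intervalIntegrable ht.le
  have hiig : IntervalIntegrable (fun s => ∫ x, g x s ^ 2) volume 1 t :=
    h.force.sq.intervalIntegrable ht.le
  have hiiw : IntervalIntegrable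
      (fun s => ∫ x, _root_.pdx i F x s * _root_.pdx i g x s) volume 1 t :=
    (hi.sol.mul hi.force).intervalIntegrable ht.le
  have hiis : IntervalIntegrable
      (fun s => ∑ j, ∫ x, _root_.pdx j (_root_.pdx i F) x s ^ 2) volume 1 t :=
    ContinuousOn.intervalIntegrable_of_Icc ht.le
      (continuousOn_finsetSum _ fun j _ => (hi.sol.pdx j).sq.continuousOn_integral t)
  have he := hi.energy_eq ht
  have hwork : ∀ s, 1 ≤ s → -2 * ∫ x, _root_.pdx i F x s * _root_.pdx i g x s
      ≤ (∑ j, ∫ x, _root_.pdx j (_root_.pdx i F) x s ^ 2) + ∫ x, g x s ^ 2 := by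
    intro s hs
    rw [hi.sol.integral_mul_pdx h.force i hs]
    have h1 : 2 * ∫ x, _root_.pdx i (_root_.pdx i F) x s * g x s
        ≤ (∫ x, _root_.pdx i (_root_.pdx i F) x s ^ 2) + ∫ x, g x s ^ 2 := by
      rw [← integral_const_mul, ← integral_add ((hi.sol.pdx i).sq.integrable hs)
        (h.force.sq.integrable hs)]
      refine integral_mono ((((hi.sol.pdx i).mul h.force).integrable hs).const_mul 2)
        (((hi.sol.pdx i).sq.integrable hs).add (h.force.sq.integrable hs)) fun x => ?_
      simp only
      nlinarith [sq_nonneg (_root_.pdx i (_root_.pdx i F) x s - g x s)]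
    have h2 := Finset.single_le_sum
      (f := fun j => ∫ x, _root_.pdx j (_root_.pdx i F) x s ^ 2)
      (fun j _ => integral_nonneg fun _ => sq_nonneg _) (Finset.mem_univ i)
    linarith
  have hmono : ∫ s in (1 : ℝ)..t, (-2 * (∑ j, ∫ x, _root_.pdx j (_root_.pdx i F) x s ^ 2)
        - 2 * ∫ x, _root_.pdx i F x s * _root_.pdx i g x s)
      ≤ ∫ s in (1 : ℝ)..t, ((∫ x, g x s ^ 2)
        - ∫ x, _root_.pdx j (_root_.pdx i F) x s ^ 2) := by
    refine intervalIntegral.integral_mono_on ht.le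
      ((hiis.const_mul _).sub (hiiw.const_mul _)) (hiig.sub (hii j)) fun s hs => ?_
    have h2 := Finset.single_le_sum
      (f := fun j => ∫ x, _root_.pdx j (_root_.pdx i F) x s ^ 2)
      (fun j _ => integral_nonneg fun _ => sq_nonneg _) (Finset.mem_univ j)
    have h3 := hwork s hs.1
    linarith
  rw [intervalIntegral.integral_sub hiig (hii j), he] at hmono
  have h0 : 0 ≤ ∫ x, _root_.pdx i F x t ^ 2 := integral_nonneg fun _ => sq_nonneg _
  linarith

end HeatSol

/-- Iterated partial derivative `∂_{I 0} ⋯ ∂_{I (k-1)} F` of a space-time function. -/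
def mdx : {k : ℕ} → (Fin k → Fin 3) → (E3 → ℝ → ℝ) → E3 → ℝ → ℝ
  | 0, _, F => F
  | _ + 1, I, F => pdx (I 0) (mdx (Fin.tail I) F)

lemma RapidSmooth.mdx {F : E3 → ℝ → ℝ} (hF : RapidSmooth F) :
    ∀ {k : ℕ} (I : Fin k → Fin 3), RapidSmooth (mdx I F)
  | 0, _ => hF
  | _ + 1, I => (RapidSmooth.mdx hF (Fin.tail I)).pdx (I 0)

lemma HeatSol.mdx {F g : E3 → ℝ → ℝ} (h : HeatSol F g) :
    ∀ {k : ℕ} (I : Fin k → Fin 3), HeatSol (mdx I F) (mdx I g)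
  | 0, _ => h
  | _ + 1, I => (HeatSol.mdx h (Fin.tail I)).pdx (I 0)

lemma mdx_eq {F : E3 → ℝ → ℝ} (hF : SmoothSlab F) {k : ℕ} (I : Fin k → Fin 3) (x : E3) {t : ℝ}
    (ht : 1 ≤ t) :
    mdx I F x t = iteratedFDeriv ℝ k (fun y => F y t) x fun j => stdVec (I j) := by
  induction k generalizing x with
  | zero => simp [mdx]
  | succ k ih =>
    have hd : HasFDerivAt (iteratedFDeriv ℝ k fun y => F y t)
        (fderiv ℝ (iteratedFDeriv ℝ k fun y => F y t) x) x :=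
      ((hF.slice ht).differentiable_iteratedFDeriv (m := k)
        (by exact_mod_cast WithTop.coe_lt_top k) x).hasFDerivAt
    have h2 := ((ContinuousMultilinearMap.apply ℝ (fun _ : Fin k => E3) ℝ
      fun j => stdVec (Fin.tail I j)).hasFDerivAt).comp x hd
    have h3 : (fun y => mdx (Fin.tail I) F y t)
        = fun y => iteratedFDeriv ℝ k (fun y => F y t) y fun j => stdVec (Fin.tail I j) :=
      funext fun y => ih (Fin.tail I) y
    rw [iteratedFDeriv_succ_apply_left]
    simp only [mdx, pdx, pd, h3]
    exact congrArg (fun L => L (stdVec (I 0))) h2.fderiv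

lemma abs_mdx_le {F : E3 → ℝ → ℝ} (hF : SmoothSlab F) {k : ℕ} (I : Fin k → Fin 3) (x : E3)
    {t : ℝ} (ht : 1 ≤ t) : |mdx I F x t| ≤ ‖iteratedFDeriv ℝ k (fun y => F y t) x‖ := by
  rw [mdx_eq hF I x ht]
  simpa [norm_stdVec] using
    (iteratedFDeriv ℝ k (fun y => F y t) x).le_opNorm fun j => stdVec (I j)

lemma norm_multilinear_le_sum {k : ℕ} (A : ContinuousMultilinearMap ℝ (fun _ : Fin k => E3) ℝ) :
    ‖A‖ ≤ ∑ I : Fin k → Fin 3, |A fun j => stdVec (I j)| := by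
  refine A.opNorm_le_bound (Finset.sum_nonneg fun _ _ => abs_nonneg _) fun v => ?_
  have hv : v = fun j => ∑ i : Fin 3, v j i • stdVec i := by
    funext j
    have h := (EuclideanSpace.basisFun (Fin 3) ℝ).sum_repr (v j)
    simpa [stdVec] using h.symm
  have hA : A v = ∑ I : Fin k → Fin 3, (∏ j, v j (I j)) • A fun j => stdVec (I j) := by
    conv_lhs => rw [hv]
    have h1 := A.toMultilinearMap.map_sum fun (j : Fin k) (i : Fin 3) => v j i • stdVec i
    refine h1.trans (Finset.sum_congr rfl fun I _ => ?_)
    exact A.toMultilinearMap.map_smul_univ (fun j => v j (I j)) fun j => stdVec (I j)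
  rw [hA, Finset.sum_mul]
  refine (norm_sum_le _ _).trans (Finset.sum_le_sum fun I _ => ?_)
  rw [norm_smul, mul_comm, Real.norm_eq_abs (A _), norm_prod]
  gcongr with j
  exact PiLp.norm_apply_le (v j) (I j)

lemma norm_iteratedFDeriv_sq_le {F : E3 → ℝ → ℝ} (hF : SmoothSlab F) (k : ℕ) (x : E3)
    {t : ℝ} (ht : 1 ≤ t) : ‖iteratedFDeriv ℝ k (fun y => F y t) x‖ ^ 2
      ≤ 3 ^ k * ∑ I : Fin k → Fin 3, mdx I F x t ^ 2 := by
  have h := norm_multilinear_le_sum (iteratedFDeriv ℝ k (fun y => F y t) x)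
  simp only [← mdx_eq hF _ x ht] at h
  calc _ ≤ (∑ I : Fin k → Fin 3, |mdx I F x t|) ^ 2 := by gcongr
    _ ≤ _ := sq_sum_le_card_mul_sum_sq
    _ = _ := by simp

lemma RapidSmooth.integrable_iteratedFDeriv_sq {F : E3 → ℝ → ℝ} (hF : RapidSmooth F) (k : ℕ) {t : ℝ}
    (ht : 1 ≤ t) : Integrable fun x => ‖iteratedFDeriv ℝ k (fun y => F y t) x‖ ^ 2 := by
  have hc : Continuous (iteratedFDeriv ℝ k fun y => F y t) :=
    (hF.1.slice ht).continuous_iteratedFDeriv (by exact_mod_cast le_top)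
  have hsum : Integrable fun x => 3 ^ k * ∑ I : Fin k → Fin 3, _root_.mdx I F x t ^ 2 :=
    (integrable_finsetSum Finset.univ fun I _ => (hF.mdx I).sq.integrable ht).const_mul (3 ^ k)
  refine hsum.mono' (hc.norm.pow 2).aestronglyMeasurable (Filter.Eventually.of_forall fun x => ?_)
  simpa using norm_iteratedFDeriv_sq_le hF.1 k x ht

lemma sobSq_nonneg (m : ℕ) (g : E3 → ℝ) : 0 ≤ sobSq m g :=
  Finset.sum_nonneg fun _ _ => integral_nonneg fun _ => by positivity

lemma sobSq_mono {m n : ℕ} (h : m ≤ n) (g : E3 → ℝ) : sobSq m g ≤ sobSq n g :=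
  Finset.sum_le_sum_of_subset_of_nonneg (Finset.range_mono (by omega))
    fun _ _ _ => integral_nonneg fun _ => by positivity

lemma RapidSmooth.integral_mdx_sq_le_sobSq {F : E3 → ℝ → ℝ} (hF : RapidSmooth F)
    {j m : ℕ} (hj : j ≤ m)
    (I : Fin j → Fin 3) : ∫ x, _root_.mdx I F x 1 ^ 2 ≤ sobSq m fun x => F x 1 := by
  refine le_trans ?_ (Finset.single_le_sum
    (f := fun j => ∫ x : E3, ‖iteratedFDeriv ℝ j (fun y => F y 1) x‖ ^ 2)
    (fun _ _ => integral_nonneg fun _ => by positivity)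
    (Finset.mem_range.2 (Nat.lt_succ_of_le hj)))
  refine integral_mono ((hF.mdx I).sq.integrable le_rfl)
    (hF.integrable_iteratedFDeriv_sq j le_rfl) fun x => ?_
  simp only
  rw [← sq_abs]
  gcongr
  exact abs_mdx_le hF.1 I x le_rfl

section Drift

variable {Ubar : E3 → E3}

/-- The `j`-th component of the self-similar drift. -/
def drift (Ubar : E3 → E3) (j : Fin 3) (x : E3) (t : ℝ) : ℝ := ubar Ubar x t j

lemma contDiff_component_s7 (hU : ContDiff ℝ (⊤ : ℕ∞) Ubar) (j : Fin 3) :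
    ContDiff ℝ (⊤ : ℕ∞) fun y => Ubar y j :=
  (EuclideanSpace.proj (𝕜 := ℝ) j).contDiff.comp hU

lemma smoothSlab_drift (hU : ContDiff ℝ (⊤ : ℕ∞) Ubar) (j : Fin 3) :
    SmoothSlab (drift Ubar j) := by
  have hc : ContDiffOn ℝ (⊤ : ℕ∞) (fun q : E3 × ℝ => q.2 ^ (-(1 : ℝ) / 2)) slab :=
    contDiff_snd.contDiffOn.rpow_const_of_ne fun q hq => (lt_of_lt_of_le one_pos hq).ne'
  have h := hc.mul ((contDiff_component_s7 hU j).comp_contDiffOn (hc.smul contDiff_fst.contDiffOn))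
  exact h.congr fun q _ => by simp [drift, ubar]

lemma drift_slice (j : Fin 3) (t : ℝ) : (fun y => drift Ubar j y t)
    = fun y => (t ^ (-(1 : ℝ) / 2)) • (fun z => Ubar ((t ^ (-(1 : ℝ) / 2)) • z) j) y := by
  funext y
  simp [drift, ubar]

lemma exists_bound_drift (hU : ContDiff ℝ (⊤ : ℕ∞) Ubar) (hUc : HasCompactSupport Ubar)
    (k : ℕ) : ∃ C : ℝ, 0 ≤ C ∧ ∀ (j : Fin 3) (x : E3) (t : ℝ), 1 ≤ t →
      ‖iteratedFDeriv ℝ k (fun y => drift Ubar j y t) x‖ ≤ C := by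
  have hb : ∀ j : Fin 3, ∃ C : ℝ, ∀ x, ‖iteratedFDeriv ℝ k (fun y => Ubar y j) x‖ ≤ C :=
    fun j => ((hUc.comp_left (g := fun v : E3 => v j) (by simp)).iteratedFDeriv
      (𝕜 := ℝ) k).exists_bound_of_continuous
      ((contDiff_component_s7 hU j).continuous_iteratedFDeriv (by exact_mod_cast le_top))
  choose C hC using hb
  have h0 : ∀ j, 0 ≤ C j := fun j => (norm_nonneg _).trans (hC j 0)
  refine ⟨∑ j, C j, Finset.sum_nonneg fun j _ => h0 j, fun j x t ht => ?_⟩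
  set c : ℝ := t ^ (-(1 : ℝ) / 2)
  have hc0 : 0 ≤ c := by positivity
  have hc1 : c ≤ 1 := Real.rpow_le_one_of_one_le_of_nonpos ht (by norm_num)
  have hsm : ContDiff ℝ k fun y => Ubar y j :=
    (contDiff_component_s7 hU j).of_le (by exact_mod_cast le_top)
  have hsm' : ContDiff ℝ k fun z => Ubar (c • z) j :=
    hsm.comp (contDiff_id.const_smul c)
  have h1 : iteratedFDeriv ℝ k (fun y => drift Ubar j y t) x
      = c • c ^ k • iteratedFDeriv ℝ k (fun y => Ubar y j) (c • x) := by
    rw [drift_slice]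
    have e1 : iteratedFDeriv ℝ k (fun y => c • (fun z => Ubar (c • z) j) y) x = _ :=
      iteratedFDeriv_const_smul_apply (a := c) hsm'.contDiffAt
    rw [e1, iteratedFDeriv_comp_const_smul c hsm]
  rw [h1, norm_smul, norm_smul, Real.norm_of_nonneg hc0, norm_pow, Real.norm_of_nonneg hc0]
  calc c * (c ^ k * ‖iteratedFDeriv ℝ k (fun y => Ubar y j) (c • x)‖)
      ≤ 1 * (1 * C j) := by
        gcongr
        · exact pow_le_one₀ hc0 hc1
        · exact hC j _
    _ ≤ ∑ j, C j := by
        simpa using Finset.single_le_sum (fun j _ => h0 j) (Finset.mem_univ j)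

lemma boundedJets_drift (hU : ContDiff ℝ (⊤ : ℕ∞) Ubar) (hUc : HasCompactSupport Ubar)
    (j : Fin 3) : BoundedJets (drift Ubar j) := fun k _ => by
  obtain ⟨C, -, hC⟩ := exists_bound_drift hU hUc k
  exact ⟨C, fun x t h1 _ => hC j x t h1⟩

lemma sum_pdx_drift (hU : ContDiff ℝ (⊤ : ℕ∞) Ubar) (hUdiv : ∀ x, divg Ubar x = 0)
    (x : E3) (t : ℝ) : ∑ j, pdx j (drift Ubar j) x t = 0 := by
  set c : ℝ := t ^ (-(1 : ℝ) / 2)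
  have h : ∀ j, pdx j (drift Ubar j) x t = c * c * pd (fun y => Ubar y j) j (c • x) := by
    intro j
    have hd : HasFDerivAt (fun y => Ubar y j) (fderiv ℝ (fun y => Ubar y j) (c • x)) (c • x) :=
      ((contDiff_component_s7 hU j).differentiable (by simp) _).hasFDerivAt
    have h1 : HasFDerivAt (fun z => Ubar (c • z) j) _ x :=
      hd.comp x ((hasFDerivAt_id x).const_smul c)
    have h2 := h1.const_smul c
    simp only [pdx, drift_slice]
    rw [pd]
    refine (congrArg (fun L => L (EuclideanSpace.single j 1)) h2.fderiv).trans ?_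
    simp [pd, mul_assoc]
  simp only [h, ← Finset.mul_sum]
  have := hUdiv (c • x)
  rw [divg] at this
  rw [this, mul_zero]

/-- The transport term `ū·∇θ`. -/
def transport (Ubar : E3 → E3) (θ : E3 → ℝ → ℝ) (x : E3) (t : ℝ) : ℝ :=
  ∑ j, drift Ubar j x t * pdx j θ x t

lemma RapidSmooth.drift_mul {F : E3 → ℝ → ℝ} (hF : RapidSmooth F) (hU : ContDiff ℝ (⊤ : ℕ∞) Ubar)
    (hUc : HasCompactSupport Ubar) (j : Fin 3) : RapidSmooth fun x t => drift Ubar j x t * F x t :=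
  ⟨(smoothSlab_drift hU j).mul hF.1,
    RapidDecay.bounded_mul (boundedJets_drift hU hUc j) hF.2 (smoothSlab_drift hU j) hF.1⟩

lemma RapidSmooth.transport {θ : E3 → ℝ → ℝ} (hθ : RapidSmooth θ) (hU : ContDiff ℝ (⊤ : ℕ∞) Ubar)
    (hUc : HasCompactSupport Ubar) : RapidSmooth (transport Ubar θ) :=
  RapidSmooth.sum fun j _ => (hθ.pdx j).drift_mul hU hUc j

lemma RapidSmooth.integral_mul_transport {θ : E3 → ℝ → ℝ} (hθ : RapidSmooth θ)
    (hU : ContDiff ℝ (⊤ : ℕ∞) Ubar) (hUc : HasCompactSupport Ubar)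
    (hUdiv : ∀ x, divg Ubar x = 0) {t : ℝ} (ht : 1 ≤ t) :
    ∫ x, θ x t * _root_.transport Ubar θ x t = 0 := by
  have hs := fun j => smoothSlab_drift hU j
  have hdv := fun j => hθ.drift_mul hU hUc j
  have ha : ∀ j ∈ Finset.univ,
      Integrable fun x => drift Ubar j x t * θ x t * _root_.pdx j θ x t :=
    fun j _ => ((hdv j).mul (hθ.pdx j)).integrable ht
  have hb : ∀ j ∈ Finset.univ, Integrable fun x => _root_.pdx j (drift Ubar j) x t * θ x t ^ 2 := by
    intro j _
    have h1 := (((hdv j).pdx j).mul hθ).integrable ht |>.sub (ha j (Finset.mem_univ j))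
    refine h1.congr (Filter.Eventually.of_forall fun x => ?_)
    simp only [Pi.sub_apply]
    rw [pdx_mul (hs j) hθ.1 j x ht]
    ring
  have hj : ∀ j, 2 * ∫ x, drift Ubar j x t * θ x t * _root_.pdx j θ x t
      = -∫ x, _root_.pdx j (drift Ubar j) x t * θ x t ^ 2 := by
    intro j
    have h1 := (hdv j).integral_mul_pdx hθ j ht
    have h2 : ∫ x, _root_.pdx j (fun x t => drift Ubar j x t * θ x t) x t * θ x t
        = (∫ x, _root_.pdx j (drift Ubar j) x t * θ x t ^ 2)
          + ∫ x, drift Ubar j x t * θ x t * _root_.pdx j θ x t := by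
      rw [← integral_add (hb j (Finset.mem_univ j)) (ha j (Finset.mem_univ j))]
      refine integral_congr_ae (Filter.Eventually.of_forall fun x => ?_)
      simp only
      rw [pdx_mul (hs j) hθ.1 j x ht]
      ring
    linarith
  have hsum : ∫ x, θ x t * _root_.transport Ubar θ x t
      = ∑ j, ∫ x, drift Ubar j x t * θ x t * _root_.pdx j θ x t := by
    rw [← integral_finsetSum _ ha]
    refine integral_congr_ae (Filter.Eventually.of_forall fun x => ?_)
    simp only [_root_.transport, Finset.mul_sum]
    exact Finset.sum_congr rfl fun j _ => by ring
  have hzero : ∑ j, ∫ x, _root_.pdx j (drift Ubar j) x t * θ x t ^ 2 = 0 := by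
    rw [← integral_finsetSum _ hb]
    simp only [← Finset.sum_mul, sum_pdx_drift hU hUdiv, zero_mul, integral_zero]
  have h2 : 2 * ∫ x, θ x t * _root_.transport Ubar θ x t = 0 := by
    rw [hsum, Finset.mul_sum, Finset.sum_congr rfl fun j _ => hj j, Finset.sum_neg_distrib,
      hzero, neg_zero]
  linarith

/-- Pointwise Leibniz bound for derivatives of the transport term. -/
lemma exists_mdx_transport_sq_le (hU : ContDiff ℝ (⊤ : ℕ∞) Ubar) (hUc : HasCompactSupport Ubar)
    (m : ℕ) : ∃ M : ℝ, 0 ≤ M ∧ ∀ θ : E3 → ℝ → ℝ, RapidSmooth θ → ∀ (J : Fin m → Fin 3) (x : E3)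
      (t : ℝ), 1 ≤ t → mdx J (transport Ubar θ) x t ^ 2
        ≤ M * ∑ i ∈ Finset.range (m + 1), ∑ I : Fin (i + 1) → Fin 3, mdx I θ x t ^ 2 := by
  choose C hC0 hC using exists_bound_drift hU hUc
  set K : ℝ := ∑ i ∈ Finset.range (m + 1), (m.choose i : ℝ) * C i
  have hKi : ∀ i ∈ Finset.range (m + 1), (m.choose i : ℝ) * C i ≤ K := fun i hi =>
    Finset.single_le_sum (f := fun i => (m.choose i : ℝ) * C i)
      (fun i _ => mul_nonneg (Nat.cast_nonneg _) (hC0 i)) hi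
  have hK0 : 0 ≤ K := Finset.sum_nonneg fun i _ => mul_nonneg (Nat.cast_nonneg _) (hC0 i)
  refine ⟨(3 * K) ^ 2 * (m + 1) * 3 ^ (m + 1), by positivity, fun θ hθ J x t ht => ?_⟩
  set N : ℕ → ℝ := fun i => ‖iteratedFDeriv ℝ i (fun y => θ y t) x‖
  have hterm : ∀ j : Fin 3,
      ‖iteratedFDeriv ℝ m (fun y => drift Ubar j y t * pdx j θ y t) x‖
        ≤ K * ∑ i ∈ Finset.range (m + 1), N (i + 1) := by
    intro j
    refine (norm_iteratedFDeriv_mul_le ((smoothSlab_drift hU j).slice ht)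
      ((hθ.pdx j).1.slice ht) x (by exact_mod_cast le_top)).trans ?_
    rw [← Finset.sum_range_reflect, Finset.mul_sum]
    refine Finset.sum_le_sum fun i hi => ?_
    have hi' : i ≤ m := Nat.lt_succ_iff.1 (Finset.mem_range.1 hi)
    have e1 : m + 1 - 1 - i = m - i := by omega
    have e2 : m - (m - i) = i := by omega
    rw [e1, e2]
    have h1 := hKi (m - i) (Finset.mem_range.2 (by omega))
    have h2 := norm_iteratedFDeriv_pdx_le hθ.1 j i x ht
    have h3 := hC (m - i) j x t ht
    calc _ ≤ (m.choose (m - i) : ℝ) * C (m - i) * N (i + 1) := by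
          gcongr
          exact mul_nonneg (Nat.cast_nonneg _) (hC0 _)
      _ ≤ K * N (i + 1) := by gcongr
  have hnorm : |mdx J (transport Ubar θ) x t|
      ≤ 3 * K * ∑ i ∈ Finset.range (m + 1), N (i + 1) := by
    refine (abs_mdx_le (hθ.transport hU hUc).1 J x ht).trans ?_
    have e : iteratedFDeriv ℝ m (fun y => transport Ubar θ y t) x = ∑ j : Fin 3,
        iteratedFDeriv ℝ m (fun y => drift Ubar j y t * pdx j θ y t) x := by
      have := iteratedFDeriv_sum (𝕜 := ℝ) (u := (Finset.univ : Finset (Fin 3))) (i := m)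
        (f := fun j y => drift Ubar j y t * pdx j θ y t) fun j _ =>
        (((hθ.pdx j).drift_mul hU hUc j).1.slice ht).of_le (by exact_mod_cast le_top)
      have h2 := congrFun this x
      rwa [Finset.sum_apply] at h2
    rw [e]
    refine (norm_sum_le _ _).trans ((Finset.sum_le_sum fun j _ => hterm j).trans ?_)
    simp [mul_assoc]
  rw [← sq_abs]
  calc |mdx J (transport Ubar θ) x t| ^ 2
      ≤ (3 * K * ∑ i ∈ Finset.range (m + 1), N (i + 1)) ^ 2 := by gcongr
    _ = (3 * K) ^ 2 * (∑ i ∈ Finset.range (m + 1), N (i + 1)) ^ 2 := by ring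
    _ ≤ (3 * K) ^ 2 * ((m + 1) * ∑ i ∈ Finset.range (m + 1), N (i + 1) ^ 2) := by
        gcongr
        simpa using sq_sum_le_card_mul_sum_sq (s := Finset.range (m + 1))
          (f := fun i => N (i + 1))
    _ ≤ (3 * K) ^ 2 * ((m + 1) * ∑ i ∈ Finset.range (m + 1),
          3 ^ (m + 1) * ∑ I : Fin (i + 1) → Fin 3, mdx I θ x t ^ 2) := by
        gcongr with i hi
        refine (norm_iteratedFDeriv_sq_le hθ.1 (i + 1) x ht).trans ?_
        have hi' : i + 1 ≤ m + 1 := Finset.mem_range.1 hi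
        have h0 : 0 ≤ ∑ I : Fin (i + 1) → Fin 3, mdx I θ x t ^ 2 :=
          Finset.sum_nonneg fun _ _ => sq_nonneg _
        gcongr
        norm_num
    _ = _ := by rw [← Finset.mul_sum]; ring

lemma IsAdmissible.rapidSmooth {θ : E3 → ℝ → ℝ} (h : IsAdmissible Ubar θ) : RapidSmooth θ :=
  ⟨h.1, h.2.2⟩

lemma IsAdmissible.heatSol {θ : E3 → ℝ → ℝ} (h : IsAdmissible Ubar θ)
    (hU : ContDiff ℝ (⊤ : ℕ∞) Ubar) (hUc : HasCompactSupport Ubar) :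
    HeatSol θ (transport Ubar θ) where
  sol := h.rapidSmooth
  force := h.rapidSmooth.transport hU hUc
  eqn x t ht := by
    have hd := (h.rapidSmooth.1.hasDerivAt_time x ht).differentiableAt.hasDerivAt
    exact hd.congr_deriv (h.2.1 x t ht.le)

/-- Space-time bound for every component of the `(k+1)`-st derivative. -/
lemma exists_spacetime_mdx_le (hU : ContDiff ℝ (⊤ : ℕ∞) Ubar) (hUc : HasCompactSupport Ubar)
    (hUdiv : ∀ x, divg Ubar x = 0) (k : ℕ) :
    ∃ C : ℝ, ∀ θ : E3 → ℝ → ℝ, IsAdmissible Ubar θ → ∀ t : ℝ, 1 < t →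
      ∀ I : Fin (k + 1) → Fin 3,
        ∫ s in (1 : ℝ)..t, ∫ x, mdx I θ x s ^ 2 ≤ C * sobSq k fun x => θ x 1 := by
  induction k using Nat.strong_induction_on with
  | _ k ih =>
  cases k with
  | zero =>
    refine ⟨1, fun θ hθ t ht I => ?_⟩
    refine ((hθ.heatSol hU hUc).energy_le_of_orthogonal
      (fun s hs => hθ.rapidSmooth.integral_mul_transport hU hUc hUdiv hs) ht (I 0)).trans ?_
    rw [one_mul]
    exact hθ.rapidSmooth.integral_mdx_sq_le_sobSq le_rfl (Fin.elim0 : Fin 0 → Fin 3)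
  | succ m =>
    have ih' : ∀ i, ∃ C : ℝ, i ∈ Finset.range (m + 1) → ∀ θ : E3 → ℝ → ℝ, IsAdmissible Ubar θ →
        ∀ t : ℝ, 1 < t → ∀ I : Fin (i + 1) → Fin 3,
          ∫ s in (1 : ℝ)..t, ∫ x, mdx I θ x s ^ 2 ≤ C * sobSq i fun x => θ x 1 := fun i => by
      by_cases hi : i < m + 1
      · obtain ⟨C, hC⟩ := ih i hi
        exact ⟨C, fun _ => hC⟩
      · exact ⟨0, fun h => absurd (Finset.mem_range.1 h) hi⟩
    choose C hC using ih'
    obtain ⟨M, hM0, hM⟩ := exists_mdx_transport_sq_le hU hUc m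
    refine ⟨1 + M * ∑ i ∈ Finset.range (m + 1), ∑ _I : Fin (i + 1) → Fin 3, |C i|,
      fun θ hθ t ht I => ?_⟩
    set S := sobSq (m + 1) fun x => θ x 1
    have hθa := hθ.rapidSmooth
    have hsol := (hθ.heatSol hU hUc).mdx (Fin.tail (Fin.tail I))
    have h1 := hsol.energy_le_pdx (Fin.tail I 0) (I 0) ht
    have h2 : ∫ x, mdx (Fin.tail I) θ x 1 ^ 2 ≤ S := hθa.integral_mdx_sq_le_sobSq le_rfl _
    have hii : ∀ i ∈ Finset.range (m + 1), ∀ I ∈ (Finset.univ : Finset (Fin (i + 1) → Fin 3)),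
        IntervalIntegrable (fun s => ∫ x, mdx I θ x s ^ 2) volume 1 t :=
      fun i _ I _ => (hθa.mdx I).sq.intervalIntegrable ht.le
    have hii' : ∀ i ∈ Finset.range (m + 1), IntervalIntegrable
        (fun s => ∑ I : Fin (i + 1) → Fin 3, ∫ x, mdx I θ x s ^ 2) volume 1 t :=
      fun i _ => ContinuousOn.intervalIntegrable_of_Icc ht.le
        (continuousOn_finsetSum _ fun I _ => (hθa.mdx I).sq.continuousOn_integral t)
    have h3 : ∫ s in (1 : ℝ)..t, ∫ x, mdx (Fin.tail (Fin.tail I)) (transport Ubar θ) x s ^ 2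
        ≤ ∫ s in (1 : ℝ)..t, M * ∑ i ∈ Finset.range (m + 1), ∑ I : Fin (i + 1) → Fin 3,
          ∫ x, mdx I θ x s ^ 2 := by
      refine intervalIntegral.integral_mono_on ht.le (hsol.force.sq.intervalIntegrable ht.le)
        (ContinuousOn.intervalIntegrable_of_Icc ht.le (continuousOn_const.mul
          (continuousOn_finsetSum _ fun i _ => continuousOn_finsetSum _ fun I _ =>
            (hθa.mdx I).sq.continuousOn_integral t))) fun s hs => ?_
      have hi1 : ∀ i ∈ Finset.range (m + 1),
          ∀ I ∈ (Finset.univ : Finset (Fin (i + 1) → Fin 3)),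
          Integrable fun x => mdx I θ x s ^ 2 := fun i _ I _ => (hθa.mdx I).sq.integrable hs.1
      have hi2 : ∀ i ∈ Finset.range (m + 1),
          Integrable fun x => ∑ I : Fin (i + 1) → Fin 3, mdx I θ x s ^ 2 :=
        fun i hi => integrable_finsetSum _ (hi1 i hi)
      rw [Finset.sum_congr rfl fun i hi => (integral_finsetSum _ (hi1 i hi)).symm,
        ← integral_finsetSum _ hi2, ← integral_const_mul]
      exact integral_mono (hsol.force.sq.integrable hs.1)
        ((integrable_finsetSum _ hi2).const_mul M) fun x => hM θ hθa _ x s hs.1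
    rw [intervalIntegral.integral_const_mul, intervalIntegral.integral_finsetSum hii'] at h3
    have h4 : ∑ i ∈ Finset.range (m + 1), ∫ s in (1 : ℝ)..t, ∑ I : Fin (i + 1) → Fin 3,
          ∫ x, mdx I θ x s ^ 2
        ≤ ∑ i ∈ Finset.range (m + 1), ∑ _I : Fin (i + 1) → Fin 3, |C i| * S := by
      refine Finset.sum_le_sum fun i hi => ?_
      rw [intervalIntegral.integral_finsetSum (hii i hi)]
      refine Finset.sum_le_sum fun I _ => (hC i hi θ hθ t ht I).trans ?_
      have hmono : (sobSq i fun x => θ x 1) ≤ S :=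
        sobSq_mono (Finset.mem_range.1 hi).le _
      have h0 := sobSq_nonneg i fun x => θ x 1
      gcongr
      exact le_abs_self _
    simp only [← Finset.sum_mul] at h4
    have h5 := mul_le_mul_of_nonneg_left h4 hM0
    calc ∫ s in (1 : ℝ)..t, ∫ x, mdx I θ x s ^ 2 ≤ _ := h1
      _ ≤ S + M * ((∑ i ∈ Finset.range (m + 1), ∑ _I : Fin (i + 1) → Fin 3, |C i|) * S) :=
          add_le_add h2 (h3.trans h5)
      _ = _ := by ring

end Drift

/-- **Space-time derivative estimate for the advected heat equation.**  For every integer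
`k ≥ 1` there is `C = C(k, Ū)` such that any admissible solution of `∂ₜθ = Δθ − ū·∇θ` on
`[1,∞)` satisfies `∫₁ᵗ ‖∇^k θ(s)‖²_{L²} ds ≤ C ‖θ(1)‖²_{H^{k−1}}` for all `t > 1`. -/
theorem advected_heat_spacetime_estimate
    (Ubar : E3 → E3) (hU : ContDiff ℝ (⊤ : ℕ∞) Ubar) (hUc : HasCompactSupport Ubar)
    (hUdiv : ∀ x, divg Ubar x = 0) :
    ∀ k : ℕ, 1 ≤ k → ∃ C : ℝ,
      ∀ θ : E3 → ℝ → ℝ, IsAdmissible Ubar θ →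
        ∀ t : ℝ, 1 < t →
          (∫ s in (1:ℝ)..t, ∫ x : E3, ‖iteratedFDeriv ℝ k (fun y => θ y s) x‖ ^ 2)
            ≤ C * sobSq (k - 1) (fun x => θ x 1) := by
  intro k hk
  obtain ⟨m, rfl⟩ := Nat.exists_eq_add_of_le' hk
  obtain ⟨C, hC⟩ := exists_spacetime_mdx_le hU hUc hUdiv m
  refine ⟨3 ^ (m + 1) * ∑ _I : Fin (m + 1) → Fin 3, C, fun θ hθ t ht => ?_⟩
  have hθa := hθ.rapidSmooth
  rw [Nat.add_sub_cancel]
  have hii : ∀ I ∈ (Finset.univ : Finset (Fin (m + 1) → Fin 3)),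
      IntervalIntegrable (fun s => ∫ x, mdx I θ x s ^ 2) volume 1 t :=
    fun I _ => (hθa.mdx I).sq.intervalIntegrable ht.le
  have hcont : ContinuousOn (fun s => 3 ^ (m + 1) * ∑ I : Fin (m + 1) → Fin 3,
      ∫ x, mdx I θ x s ^ 2) (Set.Icc 1 t) :=
    continuousOn_const.mul
      (continuousOn_finsetSum _ fun I _ => (hθa.mdx I).sq.continuousOn_integral t)
  have h1 : (∫ s in (1 : ℝ)..t, ∫ x : E3, ‖iteratedFDeriv ℝ (m + 1) (fun y => θ y s) x‖ ^ 2)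
      ≤ ∫ s in (1 : ℝ)..t, 3 ^ (m + 1) * ∑ I : Fin (m + 1) → Fin 3, ∫ x, mdx I θ x s ^ 2 := by
    rw [intervalIntegral.integral_of_le ht.le, intervalIntegral.integral_of_le ht.le]
    refine integral_mono_of_nonneg
      (Filter.Eventually.of_forall fun s => integral_nonneg fun x => by positivity)
      (hcont.intervalIntegrable_of_Icc ht.le).1 ?_
    filter_upwards [ae_restrict_mem measurableSet_Ioc] with s hs
    have hs1 : 1 ≤ s := hs.1.le
    have hi : ∀ I ∈ (Finset.univ : Finset (Fin (m + 1) → Fin 3)),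
        Integrable fun x => mdx I θ x s ^ 2 := fun I _ => (hθa.mdx I).sq.integrable hs1
    rw [← integral_finsetSum _ hi, ← integral_const_mul]
    exact integral_mono (hθa.integrable_iteratedFDeriv_sq (m + 1) hs1)
      ((integrable_finsetSum _ hi).const_mul _) fun x =>
        norm_iteratedFDeriv_sq_le hθa.1 (m + 1) x hs1
  rw [intervalIntegral.integral_const_mul, intervalIntegral.integral_finsetSum hii] at h1
  refine h1.trans ?_
  rw [mul_assoc, Finset.sum_mul]
  gcongr with I
  exact hC θ hθ t ht I
end
end
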